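/- Fix integers j ≥ 0 and k ≥ 0. Then as n → ∞, 𝒫_{n,k}^{n−j} = d_k·(k+1)^{n−j}·c(n,n−j)/n! + o((k+1)^n·n^{2j}/n!); that is, (𝒫_{n,k}^{n−j} − d_k·(k+1)^{n−j}·c(n,n−j)/n!)·n!/((k+1)^n·n^{2j}) → 0 as n → ∞. -/

import Mathlib

open Polynomial

/-- The ring `ℚ[m][t]`: polynomials in `t` with coefficients in `ℚ[m]`. -/
abbrev Qmt : Type := Polynomial (Polynomial ℚ)

/-- The element `m` of `ℚ[m][t]`. -/
noncomputable def mPoly : Qmt := Polynomial.C Polynomial.X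

/-- `f^{[d]}`: substitute `t ↦ t^d`, leaving `m` unchanged. -/
noncomputable def tPow (d : ℕ) (f : Qmt) : Qmt := f.comp (Polynomial.X ^ d)

/-- `f^{[μ]} = f^{[μ₁]} ⋯ f^{[μ_ℓ]}` for a multiset `μ` of positive integers. -/
noncomputable def tPowMul (μ : Multiset ℕ) (f : Qmt) : Qmt := (μ.map (fun d => tPow d f)).prod

/-- `z_μ = ∏ i, i ^ (mult of i) * (mult of i)!`. -/
def zPart (μ : Multiset ℕ) : ℕ := ∏ i ∈ μ.toFinset, i ^ μ.count i * (μ.count i).factorial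

/-- The plethysm `h_r ∘ f = Σ_{μ ⊢ r} z_μ⁻¹ f^{[μ]}`. -/
noncomputable def plethH (r : ℕ) (f : Qmt) : Qmt :=
  ∑ μ : Nat.Partition r, Polynomial.C (Polynomial.C ((zPart μ.parts : ℚ)⁻¹)) * tPowMul μ.parts f

/-- The polynomials `𝒬ₙ⁺ ∈ ℚ[m][t]`: `𝒬₁⁺ = m` and, for `n ≥ 2`,
`𝒬ₙ⁺ = Σ_{λ ⊢ n} (Σ_{i=1}^{ℓ(λ)-2} t^i) ∏_j (h_{r_j} ∘ 𝒬⁺_{n_j})` where `n_j` are the distinct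
parts of `λ` with multiplicities `r_j`.  (The recursion is well-founded: the term of `λ = (n)`
has coefficient `Σ_{i=1}^{1-2} t^i = 0`, so the guard `p < n` does not change any value.) -/
noncomputable def Qplus : ℕ → Qmt := fun n =>
  Nat.strongRecOn n fun n ih =>
    if n = 1 then mPoly
    else
      ∑ lam : Nat.Partition n,
        (∑ i ∈ Finset.Icc 1 (Multiset.card lam.parts - 2), (Polynomial.X : Qmt) ^ i) *
          ∏ p ∈ lam.parts.toFinset,
            plethH (lam.parts.count p) (if h : p < n then ih p h else 0)

/-- The polynomials `𝒬ₙ ∈ ℚ[m][t]`: `𝒬₁ = m` and, for `n ≥ 2`,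
`𝒬ₙ = Σ_{λ ⊢ n} ∏_j (h_{r_j} ∘ 𝒬⁺_{n_j})`. -/
noncomputable def Qfull (n : ℕ) : Qmt :=
  if n = 1 then mPoly
  else ∑ lam : Nat.Partition n, ∏ p ∈ lam.parts.toFinset, plethH (lam.parts.count p) (Qplus p)

/-- `𝒬_{n,k}(m)`: the coefficient of `t^k` in `𝒬ₙ`, a polynomial in `m`. -/
noncomputable def Qnk (n k : ℕ) : Polynomial ℚ := (Qfull n).coeff k

/-- The right-hand side `𝒬ₙ − (t/2)(Σ_{h=2}^{n-2} 𝒬_h 𝒬_{n-h} − 𝒬_{n/2}^{[2]})` of the relation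
defining `𝒫ₙ`, where `𝒬_{n/2} = 0` when `n` is odd. -/
noncomputable def Prhs (n : ℕ) : Qmt :=
  Qfull n -
    Polynomial.C (Polynomial.C ((2 : ℚ)⁻¹)) * Polynomial.X *
      ((∑ h ∈ Finset.Icc 2 (n - 2), Qfull h * Qfull (n - h)) -
        (if 2 ∣ n then tPow 2 (Qfull (n / 2)) else 0))

/-- `c_k = (k+1)^{k-1}/k!`. -/
noncomputable def ck (k : ℕ) : ℚ := ((k : ℚ) + 1) ^ ((k : ℤ) - 1) / (k.factorial : ℚ)

/-- `d_k = (k+1)^{k-2}/k!`. -/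
noncomputable def dk (k : ℕ) : ℚ := ((k : ℚ) + 1) ^ ((k : ℤ) - 2) / (k.factorial : ℚ)

/-- The signless Stirling number of the first kind `c(n,j)`: the number of permutations of an
`n`-element set with exactly `j` orbits (disjoint cycles, fixed points counted as cycles). -/
noncomputable def stirC (n j : ℕ) : ℕ :=
  Nat.card {σ : Equiv.Perm (Fin n) // σ.cycleType.card + (n - σ.support.card) = j}

/-- The Euler operator `x d/dx` on power series. -/
noncomputable def eulerD {A : Type*} [CommRing A] (F : PowerSeries A) : PowerSeries A :=
  PowerSeries.mk fun n => (n : A) * PowerSeries.coeff n F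

@[simp]
theorem coeff_eulerD {A : Type*} [CommRing A] (F : PowerSeries A) (n : ℕ) :
    PowerSeries.coeff n (eulerD F) = (n : A) * PowerSeries.coeff n F := by
  simp [eulerD]

theorem eulerD_sub {A : Type*} [CommRing A] (F G : PowerSeries A) :
    eulerD (F - G) = eulerD F - eulerD G := by
  ext n; simp [mul_sub]

theorem eulerD_one {A : Type*} [CommRing A] : eulerD (1 : PowerSeries A) = 0 := by
  ext n; by_cases h : n = 0 <;> simp [PowerSeries.coeff_one, h]

theorem eulerD_mul {A : Type*} [CommRing A] (F G : PowerSeries A) :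
    eulerD (F * G) = eulerD F * G + F * eulerD G := by
  ext n
  simp only [coeff_eulerD, map_add, PowerSeries.coeff_mul, Finset.mul_sum,
    ← Finset.sum_add_distrib]
  refine Finset.sum_congr rfl fun p hp => ?_
  rw [← Finset.HasAntidiagonal.mem_antidiagonal.mp hp]
  push_cast
  ring

theorem eulerD_C_mul {A : Type*} [CommRing A] (c : A) (F : PowerSeries A) :
    eulerD (PowerSeries.C c * F) = PowerSeries.C c * eulerD F := by
  ext n; simp only [coeff_eulerD, PowerSeries.coeff_C_mul]; ring

theorem eulerD_pow {A : Type*} [CommRing A] {E b : PowerSeries A} (h : eulerD E = b * E) (k : ℕ) :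
    eulerD (E ^ k) = (k : PowerSeries A) * b * E ^ k := by
  induction k with
  | zero => simp [eulerD_one]
  | succ k ih => rw [pow_succ, eulerD_mul, ih, h]; push_cast; ring

theorem eulerD_prod {A ι : Type*} [CommRing A] (s : Finset ι) (F B : ι → PowerSeries A)
    (h : ∀ i ∈ s, eulerD (F i) = F i * B i) :
    eulerD (∏ i ∈ s, F i) = (∏ i ∈ s, F i) * ∑ i ∈ s, B i := by
  classical
  induction s using Finset.induction_on with
  | empty => simp [eulerD_one]
  | insert a s ha ih =>
    rw [Finset.prod_insert ha, Finset.sum_insert ha, eulerD_mul, h a (by simp),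
      ih fun i hi => h i (by simp [hi])]
    ring

theorem eulerD_expand {A : Type*} [CommRing A] (p : ℕ) (hp : p ≠ 0) (F : PowerSeries A) :
    eulerD (PowerSeries.expand p hp F) = p * PowerSeries.expand p hp (eulerD F) := by
  ext n
  rw [← map_natCast (PowerSeries.C (R := A)), PowerSeries.coeff_C_mul]
  simp only [coeff_eulerD, PowerSeries.coeff_expand]
  split_ifs with h
  · obtain ⟨q, rfl⟩ := h
    rw [Nat.mul_div_cancel_left _ (Nat.pos_of_ne_zero hp)]
    push_cast; ring
  · simp

open Filter PowerSeries.WithPiTopology in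
/-- The generating function of partitions weighted by the coefficients of the series `a i`
satisfies the differential equation obtained by adding those of the factors `a i (x ^ i)`. -/
theorem eulerD_genFun {A : Type*} [CommRing A] (a b : ℕ → PowerSeries A)
    (h0 : ∀ i, PowerSeries.coeff 0 (a i) = 1) (h : ∀ i, eulerD (a i) = a i * b i) :
    eulerD (Nat.Partition.genFun fun i c => PowerSeries.coeff c (a i)) =
      (Nat.Partition.genFun fun i c => PowerSeries.coeff c (a i)) *
        PowerSeries.mk fun n => ∑ d ∈ n.divisors, (d : A) * PowerSeries.coeff (n / d) (b d) := by
  let _ : TopologicalSpace A := ⊥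
  have _ : DiscreteTopology A := ⟨rfl⟩
  have hb0 : ∀ i, PowerSeries.coeff 0 (b i) = 0 := by
    intro i
    have := congrArg (PowerSeries.coeff 0) (h i)
    rw [PowerSeries.coeff_mul] at this
    simpa [-PowerSeries.coeff_zero_eq_constantCoeff, h0] using this.symm
  set f : ℕ → ℕ → A := fun i c => PowerSeries.coeff c (a i) with hf
  have hfac : ∀ i : ℕ, (1 + ∑' j, f (i + 1) (j + 1) • (PowerSeries.X : PowerSeries A) ^
      ((i + 1) * (j + 1))) = PowerSeries.expand (i + 1) (by omega) (a (i + 1)) := by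
    intro i
    ext n
    rw [map_add, (Nat.Partition.summable_genFun_term f i).map_tsum _
      (PowerSeries.WithPiTopology.continuous_coeff _ _), PowerSeries.coeff_expand]
    simp only [map_smul, PowerSeries.coeff_X_pow, smul_eq_mul, mul_ite, mul_one, mul_zero]
    split_ifs with hd
    · obtain ⟨q, rfl⟩ := hd
      rw [Nat.mul_div_cancel_left _ (by omega)]
      rcases q with _ | q
      · simp [-PowerSeries.coeff_zero_eq_constantCoeff, h0]
      · rw [tsum_eq_single q]
        · simp [hf, PowerSeries.coeff_one]
        · intro j hj
          rw [if_neg]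
          intro hc
          have := Nat.eq_of_mul_eq_mul_left (by omega) hc
          omega
    · have : n ≠ 0 := by rintro rfl; simp at hd
      rw [PowerSeries.coeff_one, if_neg this, zero_add]
      rw [tsum_congr (g := fun _ => 0), tsum_zero]
      intro j
      rw [if_neg]
      rintro rfl
      exact hd ⟨_, rfl⟩
  have hp := Nat.Partition.hasProd_genFun f
  simp_rw [hfac] at hp
  have ht := hp.tendsto_prod_nat
  rw [PowerSeries.WithPiTopology.tendsto_iff_coeff_tendsto] at ht
  have hev : ∀ n, ∀ᶠ N in atTop, PowerSeries.coeff n (∏ i ∈ Finset.range N,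
      PowerSeries.expand (i + 1) (by omega) (a (i + 1))) =
        PowerSeries.coeff n (Nat.Partition.genFun f) := by
    intro n
    have := ht n
    rw [nhds_discrete] at this
    exact tendsto_pure.mp this
  have hder : ∀ N, eulerD (∏ i ∈ Finset.range N,
      PowerSeries.expand (i + 1) (by omega) (a (i + 1))) = (∏ i ∈ Finset.range N,
      PowerSeries.expand (i + 1) (by omega) (a (i + 1))) * ∑ i ∈ Finset.range N,
        ((i + 1 : ℕ) : PowerSeries A) * PowerSeries.expand (i + 1) (by omega) (b (i + 1)) := by
    intro N
    refine eulerD_prod _ _ _ fun i _ => ?_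
    rw [eulerD_expand, h, map_mul]
    ring
  have hsum : ∀ n N, n ≤ N → PowerSeries.coeff n (∑ i ∈ Finset.range N,
      ((i + 1 : ℕ) : PowerSeries A) * PowerSeries.expand (i + 1) (by omega) (b (i + 1))) =
      ∑ d ∈ n.divisors, (d : A) * PowerSeries.coeff (n / d) (b d) := by
    intro n N hnN
    rw [map_sum]
    have : ∀ i : ℕ, PowerSeries.coeff n (((i + 1 : ℕ) : PowerSeries A) *
        PowerSeries.expand (i + 1) (by omega) (b (i + 1))) =
        if i + 1 ∣ n then ((i + 1 : ℕ) : A) * PowerSeries.coeff (n / (i + 1)) (b (i + 1))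
        else 0 := by
      intro i
      rw [← map_natCast (PowerSeries.C (R := A)), PowerSeries.coeff_C_mul, PowerSeries.coeff_expand]
      simp
    simp_rw [this]
    rcases Nat.eq_zero_or_pos n with rfl | hn
    · simp [-PowerSeries.coeff_zero_eq_constantCoeff, hb0]
    · rw [← Finset.sum_filter]
      refine Finset.sum_bij (fun i _ => i + 1) ?_ ?_ ?_ ?_
      · intro i hi
        simp only [Finset.mem_filter] at hi
        simp [hi.2, hn.ne']
      · intro i _ j _ hij; omega
      · intro d hd
        have h1 := Nat.pos_of_mem_divisors hd
        have h2 := Nat.divisor_le hd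
        refine ⟨d - 1, ?_, by omega⟩
        simp only [Finset.mem_filter, Finset.mem_range]
        refine ⟨by omega, ?_⟩
        rw [Nat.sub_add_cancel h1]
        exact Nat.dvd_of_mem_divisors hd
      · intro i _; rfl
  ext n
  have hall : ∀ᶠ N in atTop, ∀ m ∈ Finset.range (n + 1), PowerSeries.coeff m (∏ i ∈ Finset.range N,
      PowerSeries.expand (i + 1) (by omega) (a (i + 1))) =
        PowerSeries.coeff m (Nat.Partition.genFun f) :=
    (Finset.eventually_all _).mpr fun m _ => hev m
  obtain ⟨N, hN, hnN⟩ := (hall.and (eventually_ge_atTop n)).exists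
  have := congrArg (PowerSeries.coeff n) (hder N)
  rw [coeff_eulerD, hN n (by simp), PowerSeries.coeff_mul] at this
  rw [coeff_eulerD, this, PowerSeries.coeff_mul]
  refine Finset.sum_congr rfl fun p hp => ?_
  have := Finset.HasAntidiagonal.mem_antidiagonal.mp hp
  rw [hN p.1 (by simp; omega), hsum p.2 N (by omega), PowerSeries.coeff_mk]

/-- The weight `∑_{λ ⊢ n} ∏_j h_{r_j} ∘ f_{n_j}`. -/
noncomputable def plethExp (f : ℕ → Qmt) (n : ℕ) : Qmt :=
  ∑ lam : Nat.Partition n, ∏ p ∈ lam.parts.toFinset, plethH (lam.parts.count p) (f p)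

/-- The exponential series `∑ u ^ c x ^ c / c!`. -/
noncomputable def expSeries (u : Qmt) : PowerSeries Qmt :=
  PowerSeries.mk fun c => (C (C ((c.factorial : ℚ)⁻¹)) : Qmt) * u ^ c

theorem eulerD_expSeries (u : Qmt) :
    eulerD (expSeries u) = expSeries u * (PowerSeries.C u * PowerSeries.X) := by
  ext1 n
  rw [← mul_assoc, mul_comm (expSeries u)]
  rcases n with _ | n
  · simp
  · rw [PowerSeries.coeff_succ_mul_X, PowerSeries.coeff_C_mul, coeff_eulerD, expSeries,
      PowerSeries.coeff_mk, PowerSeries.coeff_mk]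
    have : ((n + 1 : ℕ) : Qmt) = C (C ((n + 1 : ℕ) : ℚ)) := by simp
    rw [this, ← mul_assoc, ← C_mul, ← C_mul, Nat.factorial_succ]
    have h : ((n + 1 : ℕ) : ℚ) * (((n + 1) * n.factorial : ℕ) : ℚ)⁻¹ = (n.factorial : ℚ)⁻¹ := by
      have : (n.factorial : ℚ) ≠ 0 := by positivity
      push_cast
      field_simp
    rw [h]
    ring

theorem mk_plethH_eq_genFun (f : Qmt) :
    (PowerSeries.mk fun n => plethH n f) = Nat.Partition.genFun fun i c =>
      PowerSeries.coeff c (expSeries (C (C ((i : ℚ)⁻¹)) * tPow i f)) := by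
  ext1 n
  rw [PowerSeries.coeff_mk, Nat.Partition.coeff_genFun, plethH]
  refine Finset.sum_congr rfl fun μ _ => ?_
  simp only [expSeries, PowerSeries.coeff_mk, Finsupp.prod, Multiset.toFinsupp_support,
    Multiset.toFinsupp_apply, mul_pow, ← mul_assoc]
  rw [Finset.prod_mul_distrib, tPowMul, Finset.prod_multiset_map_count]
  congr 1
  simp only [← C_pow, ← C_mul, ← map_prod, zPart]
  congr 2
  push_cast
  rw [← Finset.prod_inv_distrib]
  refine Finset.prod_congr rfl fun i _ => ?_
  rw [mul_inv, inv_pow, mul_comm]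

theorem eulerD_plethH (f : Qmt) :
    eulerD (PowerSeries.mk fun n => plethH n f) = (PowerSeries.mk fun n => plethH n f) *
      PowerSeries.mk fun n => if n = 0 then 0 else tPow n f := by
  rw [mk_plethH_eq_genFun, eulerD_genFun (fun i => expSeries (C (C ((i : ℚ)⁻¹)) * tPow i f))
    (fun i => PowerSeries.C (C (C ((i : ℚ)⁻¹)) * tPow i f) * PowerSeries.X)
    (fun i => by simp [expSeries, -PowerSeries.coeff_zero_eq_constantCoeff])
    (fun i => eulerD_expSeries _)]
  congr 1
  ext1 n
  simp only [PowerSeries.coeff_mk, PowerSeries.coeff_C_mul, PowerSeries.coeff_X]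
  split_ifs with hn
  · simp [hn]
  · rw [Finset.sum_eq_single n]
    · rw [Nat.div_self (Nat.pos_of_ne_zero hn), if_pos rfl]
      have : ((n : ℕ) : Qmt) = C (C (n : ℚ)) := by simp
      rw [this, mul_one, ← mul_assoc, ← C_mul, ← C_mul,
        mul_inv_cancel₀ (by exact_mod_cast hn)]
      simp
    · intro d hd hdn
      rw [if_neg]
      · simp
      · intro h
        exact hdn (Nat.eq_of_dvd_of_div_eq_one (Nat.dvd_of_mem_divisors hd) h)
    · intro h
      exact absurd (Nat.mem_divisors_self n hn) h

theorem plethH_zero (f : Qmt) : plethH 0 f = 1 := by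
  simp [plethH, tPowMul, zPart]

theorem plethH_one (f : Qmt) : plethH 1 f = f := by
  have h := congrArg (PowerSeries.coeff 1) (eulerD_plethH f)
  rw [coeff_eulerD, PowerSeries.coeff_mul, Finset.Nat.antidiagonal_succ] at h
  simpa [-PowerSeries.coeff_zero_eq_constantCoeff, plethH_zero, tPow] using h

theorem eulerD_plethExp (f : ℕ → Qmt) :
    eulerD (PowerSeries.mk (plethExp f)) = PowerSeries.mk (plethExp f) *
      PowerSeries.mk fun n => ∑ d ∈ n.divisors, (d : Qmt) * tPow (n / d) (f d) := by
  have key : PowerSeries.mk (plethExp f) = Nat.Partition.genFun fun i c =>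
      PowerSeries.coeff c (PowerSeries.mk fun r => plethH r (f i)) := by
    ext1 n
    simp [plethExp, Finsupp.prod]
  have h := eulerD_genFun (fun i => PowerSeries.mk fun r => plethH r (f i))
    (fun i => PowerSeries.mk fun n => if n = 0 then 0 else tPow n (f i))
    (fun i => by rw [PowerSeries.coeff_mk, plethH_zero]) (fun i => eulerD_plethH _)
  rw [← key] at h
  rw [h]
  refine congrArg (fun b => PowerSeries.mk (plethExp f) * b) (PowerSeries.ext fun n => ?_)
  rw [PowerSeries.coeff_mk, PowerSeries.coeff_mk]
  refine Finset.sum_congr rfl fun d hd => ?_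
  have h0 : n / d ≠ 0 := (Nat.div_pos (Nat.divisor_le hd) (Nat.pos_of_mem_divisors hd)).ne'
  rw [PowerSeries.coeff_mk, if_neg h0]

theorem tPow_X_mul (d : ℕ) (f : Qmt) : tPow d (X * f) = X ^ d * tPow d f := by
  simp [tPow]

theorem plethH_X_mul (r : ℕ) (f : Qmt) : plethH r (X * f) = X ^ r * plethH r f := by
  simp only [plethH, Finset.mul_sum]
  refine Finset.sum_congr rfl fun μ _ => ?_
  have h : ∀ s : Multiset ℕ, tPowMul s (X * f) = X ^ s.sum * tPowMul s f := by
    intro s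
    induction s using Multiset.induction_on with
    | empty => simp [tPowMul]
    | cons a s ih =>
      have hcons : ∀ g : Qmt, tPowMul (a ::ₘ s) g = tPow a g * tPowMul s g := by
        intro g
        simp [tPowMul]
      rw [hcons, hcons, ih, Multiset.sum_cons, tPow_X_mul]
      ring
  rw [h, μ.parts_sum]
  ring

theorem plethExp_X_mul (f : ℕ → Qmt) (n : ℕ) :
    plethExp (fun i => X * f i) n = ∑ lam : Nat.Partition n, X ^ (Multiset.card lam.parts) *
      ∏ p ∈ lam.parts.toFinset, plethH (lam.parts.count p) (f p) := by
  refine Finset.sum_congr rfl fun lam _ => ?_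
  simp only [plethH_X_mul, Finset.prod_mul_distrib, Finset.prod_pow_eq_pow_sum,
    Multiset.toFinset_sum_count_eq]

theorem Qplus_one : Qplus 1 = mPoly := by
  rw [Qplus, Nat.strongRecOn_eq, if_pos rfl]

theorem Qplus_eq_sum {n : ℕ} (hn : n ≠ 1) : Qplus n =
    ∑ lam : Nat.Partition n,
        (∑ i ∈ Finset.Icc 1 (Multiset.card lam.parts - 2), (Polynomial.X : Qmt) ^ i) *
          ∏ p ∈ lam.parts.toFinset,
            plethH (lam.parts.count p) (if p < n then Qplus p else 0) := by
  rw [Qplus, Nat.strongRecOn_eq, if_neg hn]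
  simp only [dite_eq_ite]
  rfl

theorem Qplus_zero : Qplus 0 = 0 := by
  rw [Qplus_eq_sum (by norm_num)]
  simp

theorem X_mul_one_sub_X_mul_sum (k : ℕ) :
    (X * (1 - X) * ∑ i ∈ Finset.Icc 1 k, (X : Qmt) ^ i) = X ^ 2 - X ^ (k + 2) := by
  induction k with
  | zero => simp
  | succ k ih =>
    rw [Finset.sum_Icc_succ_top (by omega), mul_add, ih]
    ring

/-- The functional equation of the generating series of the `𝒬ₙ⁺`. -/
theorem plethExp_X_mul_Qplus {n : ℕ} (hn : 2 ≤ n) :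
    plethExp (fun i => X * Qplus i) n = X ^ 2 * plethExp Qplus n := by
  have hterm : ∀ lam : Nat.Partition n, X * (1 - X) *
      ((∑ i ∈ Finset.Icc 1 (Multiset.card lam.parts - 2), (Polynomial.X : Qmt) ^ i) *
          ∏ p ∈ lam.parts.toFinset,
            plethH (lam.parts.count p) (if p < n then Qplus p else 0)) =
      (X ^ 2 - X ^ (Multiset.card lam.parts)) *
        (∏ p ∈ lam.parts.toFinset, plethH (lam.parts.count p) (Qplus p)) -
        if lam = Nat.Partition.indiscrete n then (X ^ 2 - X) * Qplus n else 0 := by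
    intro lam
    by_cases hc : lam = Nat.Partition.indiscrete n
    · subst hc
      simp [Nat.Partition.indiscrete_parts (show n ≠ 0 by omega), plethH_one]
    · rw [if_neg hc, sub_zero, ← mul_assoc, X_mul_one_sub_X_mul_sum]
      have hlt : ∀ p ∈ lam.parts, p < n ∧ 2 ≤ Multiset.card lam.parts := by
        intro p hp
        obtain ⟨s, hs⟩ := Multiset.exists_cons_of_mem hp
        have hsum := lam.parts_sum
        rw [hs, Multiset.sum_cons] at hsum
        rcases Multiset.empty_or_exists_mem s with h0 | ⟨q, hq⟩
        · exfalso
          apply hc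
          ext1
          rw [Nat.Partition.indiscrete_parts (by omega), hs, h0]
          rw [h0, Multiset.sum_zero] at hsum
          simp [← hsum]
        · have h1 : q ≤ s.sum := Multiset.single_le_sum (by simp) _ hq
          have h2 : 0 < q := lam.parts_pos (by rw [hs]; simp [hq])
          have h3 : 0 < Multiset.card s := Multiset.card_pos_iff_exists_mem.mpr ⟨q, hq⟩
          rw [hs, Multiset.card_cons]
          omega
      obtain ⟨p, hp⟩ : ∃ p, p ∈ lam.parts := by
        rcases Multiset.empty_or_exists_mem lam.parts with h0 | h
        · have := lam.parts_sum
          rw [h0, Multiset.sum_zero] at this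
          omega
        · exact h
      rw [Nat.sub_add_cancel (hlt p hp).2]
      congr 1
      refine Finset.prod_congr rfl fun q hq => ?_
      rw [if_pos (hlt q (Multiset.mem_toFinset.mp hq)).1]
  have h := congrArg (fun z => X * (1 - X) * z) (Qplus_eq_sum (show n ≠ 1 by omega))
  simp only [Finset.mul_sum, hterm, Finset.sum_sub_distrib, sub_mul, Finset.sum_ite_eq',
    Finset.mem_univ, if_true] at h
  rw [plethExp_X_mul, plethExp, Finset.mul_sum]
  linear_combination h

theorem plethExp_zero (f : ℕ → Qmt) : plethExp f 0 = 1 := by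
  simp [plethExp]

theorem plethExp_one (f : ℕ → Qmt) : plethExp f 1 = f 1 := by
  have h := congrArg (PowerSeries.coeff 1) (eulerD_plethExp f)
  rw [coeff_eulerD, PowerSeries.coeff_mul, Finset.Nat.antidiagonal_succ] at h
  simpa [-PowerSeries.coeff_zero_eq_constantCoeff, plethExp_zero, tPow] using h

theorem Qfull_eq_plethExp (n : ℕ) : Qfull n = plethExp Qplus n := by
  rw [Qfull]
  split_ifs with h
  · rw [h, plethExp_one, Qplus_one]
  · rfl

theorem exists_pow_mul_pow_le (k r : ℕ) {ε : ℚ} (hε : 0 < ε) :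
    ∃ K : ℚ, 0 ≤ K ∧ ∀ n : ℕ, (n : ℚ) ^ k * ((r : ℚ) + ε / 2) ^ n ≤ K * ((r : ℚ) + ε) ^ n := by
  have hr : (0 : ℚ) ≤ r := by positivity
  obtain ⟨q, hq0, hq1, hq⟩ : ∃ q : ℚ, 0 ≤ q ∧ q < 1 ∧ (r : ℚ) + ε / 2 = q * (r + ε) :=
    ⟨(r + ε / 2) / (r + ε), by positivity, by rw [div_lt_one (by positivity)]; linarith,
      by field_simp⟩
  obtain ⟨K, hK⟩ : ∃ K : ℚ, ∀ n : ℕ, (n : ℚ) ^ k * q ^ n ≤ K := by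
    have h := tendsto_pow_const_mul_const_pow_of_lt_one k (r := (q : ℝ))
      (by exact_mod_cast hq0) (by exact_mod_cast hq1)
    obtain ⟨M, hM⟩ := h.bddAbove_range
    obtain ⟨K, hK⟩ := exists_rat_gt M
    refine ⟨K, fun n => ?_⟩
    have h1 := hM ⟨n, rfl⟩
    have h2 : ((n : ℝ) ^ k * (q : ℝ) ^ n) ≤ (K : ℝ) := h1.trans hK.le
    exact_mod_cast h2
  refine ⟨K, le_trans (by positivity) (hK 0), fun n => ?_⟩
  rw [hq, mul_pow, ← mul_assoc]
  exact mul_le_mul_of_nonneg_right (hK n) (by positivity)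

/-- The coefficient of `x ^ n` in `F` is a polynomial of degree at most `n`, and for fixed `j` its
coefficient of degree `n - j` is `O((r + ε) ^ n / n!)` for every `ε > 0`. -/
structure HasRate (r : ℕ) (F : PowerSeries ℚ[X]) : Prop where
  degree : ∀ n, (PowerSeries.coeff n F).natDegree ≤ n
  bound : ∀ (j : ℕ) (ε : ℚ), 0 < ε → ∃ K : ℚ, 0 ≤ K ∧ ∀ n : ℕ, (n.factorial : ℚ) *
    |((PowerSeries.coeff n F).reflect n).coeff j| ≤ K * ((r : ℚ) + ε) ^ n

namespace HasRate

theorem zero (r : ℕ) : HasRate r 0 :=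
  ⟨fun n => by simp, fun j ε hε => ⟨0, le_rfl, fun n => by simp⟩⟩

theorem add {r : ℕ} {F G : PowerSeries ℚ[X]} (hF : HasRate r F) (hG : HasRate r G) :
    HasRate r (F + G) := by
  refine ⟨fun n => ?_, fun j ε hε => ?_⟩
  · rw [map_add]
    exact (natDegree_add_le _ _).trans (max_le (hF.degree n) (hG.degree n))
  · obtain ⟨K, hK0, hK⟩ := hF.bound j ε hε
    obtain ⟨L, hL0, hL⟩ := hG.bound j ε hε
    refine ⟨K + L, by positivity, fun n => ?_⟩
    rw [map_add, reflect_add, coeff_add, add_mul]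
    refine le_trans ?_ (add_le_add (hK n) (hL n))
    rw [← mul_add]
    exact mul_le_mul_of_nonneg_left (abs_add_le _ _) (by positivity)

theorem C_mul {r : ℕ} {F : PowerSeries ℚ[X]} (hF : HasRate r F) (q : ℚ) :
    HasRate r (PowerSeries.C (C q) * F) := by
  refine ⟨fun n => ?_, fun j ε hε => ?_⟩
  · rw [PowerSeries.coeff_C_mul]
    exact (natDegree_C_mul_le _ _).trans (hF.degree n)
  · obtain ⟨K, hK0, hK⟩ := hF.bound j ε hε
    refine ⟨|q| * K, by positivity, fun n => ?_⟩
    rw [PowerSeries.coeff_C_mul, reflect_C_mul, coeff_C_mul, abs_mul, mul_left_comm, mul_assoc]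
    exact mul_le_mul_of_nonneg_left (hK n) (by positivity)

theorem neg {r : ℕ} {F : PowerSeries ℚ[X]} (hF : HasRate r F) : HasRate r (-F) := by
  have := hF.C_mul (-1)
  simpa using this

theorem sub {r : ℕ} {F G : PowerSeries ℚ[X]} (hF : HasRate r F) (hG : HasRate r G) :
    HasRate r (F - G) := by
  rw [sub_eq_add_neg]
  exact hF.add hG.neg

theorem sum {r : ℕ} {ι : Type*} (s : Finset ι) {F : ι → PowerSeries ℚ[X]}
    (hF : ∀ i ∈ s, HasRate r (F i)) : HasRate r (∑ i ∈ s, F i) := by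
  classical
  induction s using Finset.induction_on with
  | empty => simpa using zero r
  | insert a s ha ih =>
    rw [Finset.sum_insert ha]
    exact (hF a (by simp)).add (ih fun i hi => hF i (by simp [hi]))

theorem mono {r s : ℕ} (hrs : r ≤ s) {F : PowerSeries ℚ[X]} (hF : HasRate r F) : HasRate s F := by
  refine ⟨hF.degree, fun j ε hε => ?_⟩
  obtain ⟨K, hK0, hK⟩ := hF.bound j ε hε
  refine ⟨K, hK0, fun n => (hK n).trans ?_⟩
  gcongr

theorem mul {r s : ℕ} {F G : PowerSeries ℚ[X]} (hF : HasRate r F) (hG : HasRate s G) :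
    HasRate (r + s) (F * G) := by
  refine ⟨fun n => ?_, fun j ε hε => ?_⟩
  · rw [PowerSeries.coeff_mul]
    refine natDegree_sum_le_of_forall_le _ _ fun p hp => ?_
    rw [← Finset.HasAntidiagonal.mem_antidiagonal.mp hp]
    exact natDegree_mul_le.trans (add_le_add (hF.degree _) (hG.degree _))
  · choose K hK0 hK using fun i => hF.bound i (ε / 2) (by positivity)
    choose L hL0 hL using fun i => hG.bound i (ε / 2) (by positivity)
    refine ⟨∑ i ∈ Finset.HasAntidiagonal.antidiagonal j, K i.1 * L i.2,
      Finset.sum_nonneg fun i _ => mul_nonneg (hK0 _) (hL0 _), fun n => ?_⟩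
    have e1 : ((PowerSeries.coeff n (F * G)).reflect n).coeff j =
        ∑ p ∈ Finset.HasAntidiagonal.antidiagonal n, ∑ i ∈ Finset.HasAntidiagonal.antidiagonal j,
          ((PowerSeries.coeff p.1 F).reflect p.1).coeff i.1 *
            ((PowerSeries.coeff p.2 G).reflect p.2).coeff i.2 := by
      rw [PowerSeries.coeff_mul]
      have : ∀ s : Finset (ℕ × ℕ), ((∑ p ∈ s, PowerSeries.coeff p.1 F *
          PowerSeries.coeff p.2 G).reflect n).coeff j =
          ∑ p ∈ s, ((PowerSeries.coeff p.1 F * PowerSeries.coeff p.2 G).reflect n).coeff j := by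
        intro s
        simp only [coeff_reflect, finsetSum_coeff]
      rw [this]
      refine Finset.sum_congr rfl fun p hp => ?_
      rw [← Finset.HasAntidiagonal.mem_antidiagonal.mp hp,
        reflect_mul _ _ (hF.degree _) (hG.degree _), coeff_mul]
    have e2 : ((r + s : ℕ) : ℚ) + ε = (r + ε / 2) + (s + ε / 2) := by push_cast; ring
    rw [e1, e2, (Commute.all _ _).add_pow', Finset.mul_sum]
    refine (mul_le_mul_of_nonneg_left (Finset.abs_sum_le_sum_abs _ _) (by positivity)).trans ?_
    rw [Finset.mul_sum]
    refine Finset.sum_le_sum fun p hp => ?_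
    refine (mul_le_mul_of_nonneg_left (Finset.abs_sum_le_sum_abs _ _) (by positivity)).trans ?_
    rw [Finset.mul_sum, Finset.sum_mul]
    refine Finset.sum_le_sum fun i _ => ?_
    have hp' := Finset.HasAntidiagonal.mem_antidiagonal.mp hp
    have hfac : (n.factorial : ℚ) = n.choose p.1 * (p.1.factorial * p.2.factorial) := by
      have := Nat.choose_mul_factorial_mul_factorial (show p.1 ≤ n by omega)
      rw [show n - p.1 = p.2 by omega] at this
      rw [← this]; push_cast; ring
    rw [hfac, abs_mul, nsmul_eq_mul]
    have h := mul_le_mul (hK i.1 p.1) (hL i.2 p.2) (by positivity)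
      (mul_nonneg (hK0 _) (by positivity))
    have h2 := mul_le_mul_of_nonneg_left h (Nat.cast_nonneg (α := ℚ) (n.choose p.1))
    calc _ = _ := by ring
      _ ≤ _ := h2
      _ = _ := by ring

theorem one : HasRate 0 1 := by
  refine ⟨fun n => ?_, fun j ε hε => ⟨1, zero_le_one, fun n => ?_⟩⟩
  · rw [PowerSeries.coeff_one]; split_ifs <;> simp
  · rw [PowerSeries.coeff_one]
    split_ifs with h
    · subst h
      simp only [Nat.factorial_zero, coeff_reflect, coeff_one]
      split_ifs <;> simp
    · simp; positivity

theorem pow {E : PowerSeries ℚ[X]} (hE : HasRate 1 E) (k : ℕ) : HasRate k (E ^ k) := by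
  induction k with
  | zero => simpa using one
  | succ k ih => rw [pow_succ]; exact ih.mul hE

theorem eulerD {r : ℕ} {F : PowerSeries ℚ[X]} (hF : HasRate r F) : HasRate r (eulerD F) := by
  have hcast : ∀ n : ℕ, (n : ℚ[X]) = C (n : ℚ) := fun n => by simp
  refine ⟨fun n => ?_, fun j ε hε => ?_⟩
  · rw [coeff_eulerD, hcast]
    exact (natDegree_C_mul_le _ _).trans (hF.degree n)
  · obtain ⟨K, hK0, hK⟩ := hF.bound j (ε / 2) (by positivity)
    obtain ⟨L, hL0, hL⟩ := exists_pow_mul_pow_le 1 r hε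
    refine ⟨K * L, by positivity, fun n => ?_⟩
    rw [coeff_eulerD, hcast, reflect_C_mul, coeff_C_mul, abs_mul, Nat.abs_cast, mul_left_comm]
    calc _ ≤ (n : ℚ) * (K * (r + ε / 2) ^ n) := mul_le_mul_of_nonneg_left (hK n) (by positivity)
      _ = K * ((n : ℚ) ^ 1 * (r + ε / 2) ^ n) := by ring
      _ ≤ K * (L * (r + ε) ^ n) := mul_le_mul_of_nonneg_left (hL n) hK0
      _ = _ := by ring

theorem of_eulerD {r : ℕ} {F : PowerSeries ℚ[X]} (hF : HasRate r (_root_.eulerD F))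
    (h0 : (PowerSeries.coeff 0 F).natDegree = 0) : HasRate r F := by
  have hcast : ∀ n : ℕ, (n : ℚ[X]) = C (n : ℚ) := fun n => by simp
  refine ⟨fun n => ?_, fun j ε hε => ?_⟩
  · rcases Nat.eq_zero_or_pos n with rfl | hn
    · exact h0.le
    · have := hF.degree n
      rwa [coeff_eulerD, hcast, natDegree_C_mul (by positivity)] at this
  · obtain ⟨K, hK0, hK⟩ := hF.bound j ε hε
    refine ⟨K + |((PowerSeries.coeff 0 F).reflect 0).coeff j|, by positivity, fun n => ?_⟩
    rcases Nat.eq_zero_or_pos n with rfl | hn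
    · simp [-PowerSeries.coeff_zero_eq_constantCoeff, hK0]
    · have := hK n
      rw [coeff_eulerD, hcast, reflect_C_mul, coeff_C_mul, abs_mul, Nat.abs_cast] at this
      have h1 : (1 : ℚ) ≤ n := by exact_mod_cast hn
      refine le_trans (mul_le_mul_of_nonneg_left ?_ (by positivity)) (this.trans ?_)
      · exact le_mul_of_one_le_left (abs_nonneg _) h1
      · rw [add_mul]
        exact le_add_of_nonneg_right (by positivity)

theorem of_finite {F : PowerSeries ℚ[X]} (hd : ∀ n, (PowerSeries.coeff n F).natDegree ≤ n)
    (h : ∀ j, ∃ N, ∀ n, N < n → ((PowerSeries.coeff n F).reflect n).coeff j = 0) :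
    HasRate 0 F := by
  refine ⟨hd, fun j ε hε => ?_⟩
  obtain ⟨N, hN⟩ := h j
  refine ⟨∑ n ∈ Finset.range (N + 1), (n.factorial : ℚ) *
    |((PowerSeries.coeff n F).reflect n).coeff j| / ε ^ n,
    Finset.sum_nonneg fun n _ => by positivity, fun n => ?_⟩
  rw [Nat.cast_zero, zero_add]
  by_cases hn : N < n
  · rw [hN n hn, abs_zero, mul_zero]
    exact mul_nonneg (Finset.sum_nonneg fun n _ => by positivity) (by positivity)
  · rw [← div_le_iff₀ (by positivity)]
    exact Finset.single_le_sum (f := fun n => (n.factorial : ℚ) *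
      |((PowerSeries.coeff n F).reflect n).coeff j| / ε ^ n) (fun n _ => by positivity)
      (by simp; omega)

theorem of_natDegree_le_half {F : PowerSeries ℚ[X]}
    (hd : ∀ n, (PowerSeries.coeff n F).natDegree ≤ n / 2) : HasRate 0 F := by
  refine of_finite (fun n => (hd n).trans (Nat.div_le_self _ _)) fun j => ⟨2 * j, fun n hn => ?_⟩
  rw [coeff_reflect, revAt_le (by omega)]
  exact coeff_eq_zero_of_natDegree_lt (lt_of_le_of_lt (hd n) (by omega))

theorem of_coeff_eq_zero {F : PowerSeries ℚ[X]} (N : ℕ)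
    (hd : ∀ n, (PowerSeries.coeff n F).natDegree ≤ n)
    (h : ∀ n, N < n → PowerSeries.coeff n F = 0) : HasRate 0 F :=
  of_finite hd fun j => ⟨N, fun n hn => by simp [h n hn]⟩

/-- Changing finitely many coefficients, within the degree bounds, preserves the rate. -/
theorem congr {r : ℕ} {F G : PowerSeries ℚ[X]} (hF : HasRate r F) (N : ℕ)
    (hd : ∀ n, (PowerSeries.coeff n G).natDegree ≤ n)
    (h : ∀ n, N < n → PowerSeries.coeff n F = PowerSeries.coeff n G) : HasRate r G := by
  have : HasRate 0 (G - F) := of_coeff_eq_zero N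
    (fun n => by
      rw [map_sub]
      exact (natDegree_sub_le _ _).trans (max_le (hd n) (hF.degree n)))
    (fun n hn => by rw [map_sub, h n hn, sub_self])
  simpa using (this.mono (Nat.zero_le r)).add hF

end HasRate

/-- The series of the coefficients of `t ^ k`. -/
noncomputable def tCoeff (k : ℕ) (F : PowerSeries Qmt) : PowerSeries ℚ[X] :=
  PowerSeries.mk fun n => (PowerSeries.coeff n F).coeff k

@[simp]
theorem coeff_tCoeff (k n : ℕ) (F : PowerSeries Qmt) :
    PowerSeries.coeff n (tCoeff k F) = (PowerSeries.coeff n F).coeff k := by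
  simp [tCoeff]

theorem tCoeff_mul (k : ℕ) (F G : PowerSeries Qmt) :
    tCoeff k (F * G) = ∑ p ∈ Finset.HasAntidiagonal.antidiagonal k, tCoeff p.1 F * tCoeff p.2 G := by
  ext1 n
  simp only [coeff_tCoeff, PowerSeries.coeff_mul, map_sum, finsetSum_coeff, coeff_mul]
  exact Finset.sum_comm

theorem tCoeff_eulerD (k : ℕ) (F : PowerSeries Qmt) :
    tCoeff k (eulerD F) = eulerD (tCoeff k F) := by
  ext1 n
  rw [coeff_tCoeff, coeff_eulerD, coeff_eulerD, coeff_tCoeff, coeff_natCast_mul]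

theorem tCoeff_add (k : ℕ) (F G : PowerSeries Qmt) :
    tCoeff k (F + G) = tCoeff k F + tCoeff k G := by
  ext1 n; simp

theorem tCoeff_sub (k : ℕ) (F G : PowerSeries Qmt) :
    tCoeff k (F - G) = tCoeff k F - tCoeff k G := by
  ext1 n; simp

theorem tCoeff_zero_X_mul (F : PowerSeries Qmt) :
    tCoeff 0 (PowerSeries.C (X : Qmt) * F) = 0 := by
  ext1 n; simp

theorem tCoeff_succ_X_mul (k : ℕ) (F : PowerSeries Qmt) :
    tCoeff (k + 1) (PowerSeries.C (X : Qmt) * F) = tCoeff k F := by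
  ext1 n; simp

theorem sum_choose_mul_neg_one_pow_mul_pow {n : ℕ} (m : ℕ) (hm : m < n) :
    ∑ k ∈ Finset.range (n + 1), (n.choose k : ℚ) * ((-1) ^ (n - k) * ((k : ℚ) + 1) ^ m) = 0 := by
  have h := Polynomial.fwdDiff_iter_eq_zero_of_degree_lt (P := ((X : ℚ[X]) + 1) ^ m) (n := n) (by
    have : ((X : ℚ[X]) + 1).natDegree = 1 := by simpa using natDegree_X_add_C (1 : ℚ)
    rw [natDegree_pow, this]; omega)
  have h2 := congrFun h 0
  rw [fwdDiff_iter_eq_sum_shift] at h2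
  refine Eq.trans ?_ h2
  refine Finset.sum_congr rfl fun k _ => ?_
  simp
  ring

/-- Abel's binomial identity, as an identity of polynomials in one of the two variables. -/
theorem sum_choose_mul_abel (n : ℕ) :
    ∑ k ∈ Finset.range (n + 1), C ((n.choose k : ℚ) * ((k : ℚ) + 1) ^ ((k : ℤ) - 1)) *
      (X + C (((n - k : ℕ) : ℚ))) ^ (n - k) = (X + C ((n : ℚ) + 1)) ^ n := by
  induction n with
  | zero => simp
  | succ n ih =>
    have hder : derivative (∑ k ∈ Finset.range (n + 1 + 1),
        C (((n + 1).choose k : ℚ) * ((k : ℚ) + 1) ^ ((k : ℤ) - 1)) *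
          (X + C (((n + 1 - k : ℕ) : ℚ))) ^ (n + 1 - k) - (X + C (((n + 1 : ℕ) : ℚ) + 1)) ^ (n + 1))
          = 0 := by
      have h1 := congrArg (fun p : ℚ[X] => C ((n : ℚ) + 1) * p.comp (X + C 1)) ih
      simp only [Polynomial.sum_comp, mul_comp, C_comp, pow_comp, add_comp, X_comp] at h1
      rw [derivative_sub, derivative_sum, sub_eq_zero, Finset.sum_range_succ]
      simp only [derivative_mul, derivative_C, derivative_X_add_C_pow, zero_mul, zero_add,
        Nat.sub_self, pow_zero, derivative_one, Nat.cast_zero, map_zero, mul_zero, add_zero,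
        add_tsub_cancel_right]
      have h2 : (X : ℚ[X]) + C 1 + C ((n : ℚ) + 1) = X + C (((n + 1 : ℕ) : ℚ) + 1) := by
        rw [add_assoc, ← C_add]; push_cast; ring_nf
      rw [h2] at h1
      rw [show C ((n + 1 : ℕ) : ℚ) = C ((n : ℚ) + 1) by push_cast; rfl]
      refine Eq.trans ?_ h1
      rw [Finset.mul_sum]
      refine Finset.sum_congr rfl fun k hk => ?_
      have hk : k ≤ n := by simpa [Nat.lt_succ_iff] using hk
      have h4 : (X : ℚ[X]) + C (((n + 1 - k : ℕ) : ℚ)) = X + C 1 + C (((n - k : ℕ) : ℚ)) := by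
        rw [add_assoc, ← C_add, Nat.succ_sub hk]; push_cast; ring_nf
      have h5 : (((n + 1).choose k : ℚ)) * ((n + 1 - k : ℕ) : ℚ) = ((n : ℚ) + 1) * n.choose k := by
        have := Nat.choose_mul_succ_eq n k
        rw [mul_comm] at this
        exact_mod_cast this.symm
      rw [h4, show n + 1 - k - 1 = n - k by omega, ← mul_assoc, ← mul_assoc,
        ← C_mul, ← C_mul]
      congr 2
      linear_combination ((k : ℚ) + 1) ^ ((k : ℤ) - 1) * h5
    obtain ⟨c, hc⟩ : ∃ c, _ = C c := ⟨_, eq_C_of_derivative_eq_zero hder⟩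
    have hev := congrArg (eval (-((n : ℚ) + 2))) hc
    rw [← sub_eq_zero, hc]
    rw [eval_C] at hev
    rw [← hev, ← C_0]
    congr 1
    rw [eval_sub, eval_finsetSum]
    have h6 := sum_choose_mul_neg_one_pow_mul_pow n (Nat.lt_succ_self n)
    simp only [eval_mul, eval_C, eval_pow, eval_add, eval_X]
    rw [show -((n : ℚ) + 2) + (((n + 1 : ℕ) : ℚ) + 1) = 0 by push_cast; ring,
      zero_pow (Nat.succ_ne_zero n), sub_zero, ← h6]
    refine Finset.sum_congr rfl fun k hk => ?_
    have hk : k ≤ n + 1 := by simpa [Nat.lt_succ_iff] using hk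
    rw [show -((n : ℚ) + 2) + ((n + 1 - k : ℕ) : ℚ) = (-1) * ((k : ℚ) + 1) by
      rw [Nat.cast_sub hk]; push_cast; ring, mul_pow, mul_assoc]
    congr 1
    rw [mul_left_comm]
    congr 1
    have h0 : ((k : ℚ) + 1) ≠ 0 := by positivity
    rw [← zpow_natCast, ← zpow_natCast, ← zpow_add₀ h0]
    congr 1
    omega

theorem sum_ck_mul_ck (N : ℕ) :
    ((N : ℚ) + 2) * ∑ p ∈ Finset.HasAntidiagonal.antidiagonal N, ck p.1 * ck p.2 =
      2 * ((N : ℚ) + 2) ^ N / N.factorial := by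
  have h := congrArg (eval 1) (sum_choose_mul_abel N)
  simp only [eval_finsetSum, eval_mul, eval_C, eval_pow, eval_add, eval_X] at h
  have h1 : ∑ p ∈ Finset.HasAntidiagonal.antidiagonal N, ck p.1 * (((p.2 : ℚ) + 1) * ck p.2) =
      ((N : ℚ) + 2) ^ N / N.factorial := by
    rw [Finset.Nat.sum_antidiagonal_eq_sum_range_succ_mk, eq_div_iff (by positivity),
      show ((N : ℚ) + 2) = 1 + (N + 1) by ring, ← h, Finset.sum_mul]
    refine Finset.sum_congr rfl fun k hk => ?_
    have hk : k ≤ N := by simpa [Nat.lt_succ_iff] using hk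
    have h0 : (((N - k : ℕ) : ℚ) + 1) ≠ 0 := by positivity
    have h2 := Nat.choose_mul_factorial_mul_factorial hk
    have h3 : (N.factorial : ℚ) = N.choose k * k.factorial * (N - k).factorial := by
      exact_mod_cast h2.symm
    simp only [ck]
    rw [h3, zpow_sub_one₀ h0, zpow_natCast, add_comm 1 (((N - k : ℕ) : ℚ))]
    field_simp
  have h2 : ∑ p ∈ Finset.HasAntidiagonal.antidiagonal N, ck p.1 * (((p.2 : ℚ) + 1) * ck p.2) =
      ∑ p ∈ Finset.HasAntidiagonal.antidiagonal N, (((p.1 : ℚ) + 1) * ck p.1) * ck p.2 := by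
    rw [← Finset.Nat.sum_antidiagonal_swap]
    exact Finset.sum_congr rfl fun p _ => by simp only [Prod.fst_swap, Prod.snd_swap]; ring
  have h3 : ((N : ℚ) + 2) * ∑ p ∈ Finset.HasAntidiagonal.antidiagonal N, ck p.1 * ck p.2 =
      ∑ p ∈ Finset.HasAntidiagonal.antidiagonal N, ck p.1 * (((p.2 : ℚ) + 1) * ck p.2) +
      ∑ p ∈ Finset.HasAntidiagonal.antidiagonal N, (((p.1 : ℚ) + 1) * ck p.1) * ck p.2 := by
    rw [Finset.mul_sum, ← Finset.sum_add_distrib]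
    refine Finset.sum_congr rfl fun p hp => ?_
    have : (N : ℚ) = p.1 + p.2 := by
      exact_mod_cast (Finset.HasAntidiagonal.mem_antidiagonal.mp hp).symm
    rw [this]; ring
  rw [h3, ← h2, h1]; ring

theorem sum_succ_mul_ck_mul_ck (N : ℕ) :
    ∑ p ∈ Finset.HasAntidiagonal.antidiagonal N, (((p.1 : ℚ) + 1) * ck p.1) * ck p.2 =
      ((N : ℚ) + 1) * ck (N + 1) := by
  have h1 : 2 * ∑ p ∈ Finset.HasAntidiagonal.antidiagonal N, (((p.1 : ℚ) + 1) * ck p.1) * ck p.2 =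
      ((N : ℚ) + 2) * ∑ p ∈ Finset.HasAntidiagonal.antidiagonal N, ck p.1 * ck p.2 := by
    rw [two_mul]
    nth_rewrite 1 [← Finset.Nat.sum_antidiagonal_swap]
    rw [Finset.mul_sum, ← Finset.sum_add_distrib]
    refine Finset.sum_congr rfl fun p hp => ?_
    have : (N : ℚ) = p.1 + p.2 := by
      exact_mod_cast (Finset.HasAntidiagonal.mem_antidiagonal.mp hp).symm
    rw [this]; simp only [Prod.fst_swap, Prod.snd_swap]; ring
  rw [sum_ck_mul_ck] at h1
  have h2 : ck (N + 1) = ((N : ℚ) + 2) ^ N / (N + 1).factorial := by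
    rw [ck, show ((N + 1 : ℕ) : ℤ) - 1 = (N : ℤ) by push_cast; ring, zpow_natCast]
    push_cast; ring_nf
  rw [h2, Nat.factorial_succ]
  have : ((N : ℚ) + 1) ≠ 0 := by positivity
  push_cast
  field_simp
  field_simp at h1
  linarith

theorem ck_succ_sub_half_sum (N : ℕ) :
    ck (N + 1) - 2⁻¹ * ∑ p ∈ Finset.HasAntidiagonal.antidiagonal N, ck p.1 * ck p.2 =
      dk (N + 1) := by
  have h1 := sum_ck_mul_ck N
  have h0 : ((N : ℚ) + 2) ≠ 0 := by positivity
  have h3 : ((N : ℚ) + 1) ≠ 0 := by positivity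
  have h2 : ck (N + 1) = ((N : ℚ) + 2) ^ N / (N + 1).factorial := by
    rw [ck, show ((N + 1 : ℕ) : ℤ) - 1 = (N : ℤ) by push_cast; ring, zpow_natCast]
    push_cast; ring_nf
  have h4 : dk (N + 1) = ((N : ℚ) + 2) ^ N / (N + 2) / (N + 1).factorial := by
    rw [dk, show ((N + 1 : ℕ) : ℤ) - 2 = (N : ℤ) - 1 by push_cast; ring,
      show ((N + 1 : ℕ) : ℚ) + 1 = N + 2 by push_cast; ring, zpow_sub_one₀ h0, zpow_natCast,
      div_eq_mul_inv (_ ^ N)]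
  rw [mul_comm, ← eq_div_iff h0] at h1
  rw [h1, h2, h4, Nat.factorial_succ]
  push_cast
  field_simp
  ring

theorem zPart_add_replicate_one {m : Multiset ℕ} (hm : ∀ a ∈ m, 2 ≤ a) (k : ℕ) :
    zPart (m + Multiset.replicate k 1) =
      k.factorial * m.prod * ∏ a ∈ m.toFinset, (m.count a).factorial := by
  have h1 : (1 : ℕ) ∉ m.toFinset := fun h => by
    have := hm 1 (Multiset.mem_toFinset.mp h); omega
  have hc : m.count 1 = 0 := by
    rwa [Multiset.count_eq_zero, ← Multiset.mem_toFinset]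
  have hz : zPart m = m.prod * ∏ a ∈ m.toFinset, (m.count a).factorial := by
    rw [zPart, Finset.prod_mul_distrib, ← Finset.prod_multiset_count]
  rcases Nat.eq_zero_or_pos k with rfl | hk
  · simp [hz]
  · have ht : (m + Multiset.replicate k 1).toFinset = insert 1 m.toFinset := by
      ext a
      simp [hk.ne', or_comm]
    rw [zPart, ht, Finset.prod_insert h1, mul_assoc k.factorial, ← hz, zPart]
    congr 1
    · simp [hc]
    · refine Finset.prod_congr rfl fun a ha => ?_
      have : a ≠ 1 := fun h => h1 (h ▸ ha)
      simp [Multiset.count_replicate, this.symm]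

theorem Nat.Partition.parts_eq_filter_add_replicate {n : ℕ} (p : Nat.Partition n) :
    p.parts = p.parts.filter (2 ≤ ·) +
      Multiset.replicate (n - (p.parts.filter (2 ≤ ·)).sum) 1 := by
  have h1 : p.parts.filter (fun a => ¬ 2 ≤ a) =
      Multiset.replicate (p.parts.filter (fun a => ¬ 2 ≤ a)).card 1 := by
    refine Multiset.eq_replicate_card.mpr fun a ha => ?_
    have := p.parts_pos (Multiset.mem_of_mem_filter ha)
    have := Multiset.of_mem_filter ha
    omega
  have h2 := Multiset.filter_add_not (2 ≤ ·) p.parts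
  have h3 := congrArg Multiset.sum h2
  rw [Multiset.sum_add, p.parts_sum, h1, Multiset.sum_replicate, smul_eq_mul, mul_one] at h3
  conv_lhs => rw [← h2, h1]
  congr 2
  omega

theorem Equiv.Perm.partition_eq_iff_cycleType_eq {α : Type*} [Fintype α] [DecidableEq α]
    (σ : Equiv.Perm α) (p : (Fintype.card α).Partition) :
    σ.partition = p ↔ σ.cycleType = p.parts.filter (2 ≤ ·) := by
  constructor
  · rintro rfl
    exact filter_parts_partition_eq_cycleType.symm
  · intro h
    rw [← filter_parts_partition_eq_cycleType] at h
    ext1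
    rw [σ.partition.parts_eq_filter_add_replicate, p.parts_eq_filter_add_replicate, h]

theorem card_partition_eq_mul_zPart {α : Type*} [Fintype α] [DecidableEq α]
    (p : (Fintype.card α).Partition) :
    Finset.card {σ : Equiv.Perm α | σ.partition = p} * zPart p.parts =
      (Fintype.card α).factorial := by
  have h2 : ∀ a ∈ p.parts.filter (2 ≤ ·), 2 ≤ a := fun a ha => (Multiset.mem_filter.mp ha).2
  have h := Equiv.Perm.card_of_cycleType_mul_eq α (p.parts.filter (2 ≤ ·))
  rw [if_pos ⟨by
    conv_rhs => rw [← p.parts_sum, p.parts_eq_filter_add_replicate, Multiset.sum_add]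
    exact Nat.le_add_right _ _, h2⟩] at h
  rw [← h, p.parts_eq_filter_add_replicate, zPart_add_replicate_one h2,
    ← p.parts_eq_filter_add_replicate]
  simp only [Equiv.Perm.partition_eq_iff_cycleType_eq]

theorem tPow_mPoly (d : ℕ) : tPow d mPoly = mPoly := by
  simp [tPow, mPoly]

theorem coeff_coeff_zero_plethH_mPoly (n i : ℕ) :
    ((plethH n mPoly).coeff 0).coeff i = (stirC n i : ℚ) / n.factorial := by
  have hterm : ∀ p : n.Partition, ((Polynomial.C (Polynomial.C ((zPart p.parts : ℚ)⁻¹)) *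
      tPowMul p.parts mPoly : Qmt).coeff 0).coeff i =
        if i = p.parts.card then (zPart p.parts : ℚ)⁻¹ else 0 := by
    intro p
    simp only [tPowMul, tPow_mPoly, Multiset.map_const', Multiset.prod_replicate]
    rw [mPoly, ← C_pow, ← C_mul, coeff_C_zero, coeff_C_mul, coeff_X_pow]
    simp
  simp only [plethH, finsetSum_coeff, hterm]
  have key : ∀ (α : Type) [Fintype α] [DecidableEq α],
      (Nat.card {σ : Equiv.Perm α //
        σ.cycleType.card + (Fintype.card α - σ.support.card) = i} : ℚ) /
          (Fintype.card α).factorial =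
        ∑ p : (Fintype.card α).Partition,
          if i = p.parts.card then (zPart p.parts : ℚ)⁻¹ else 0 := by
    intro α _ _
    rw [Nat.card_eq_fintype_card, Fintype.card_subtype,
      Finset.card_eq_sum_card_fiberwise (f := fun σ : Equiv.Perm α => σ.partition)
        (t := Finset.univ) (fun _ _ => by simp), Nat.cast_sum, Finset.sum_div]
    refine Finset.sum_congr rfl fun p _ => ?_
    rw [Finset.filter_filter]
    have hf : ((Fintype.card α).factorial : ℚ) ≠ 0 := by positivity
    split_ifs with h
    · rw [div_eq_iff hf, ← card_partition_eq_mul_zPart p]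
      have hz : (zPart p.parts : ℚ) ≠ 0 := by
        intro h0
        have := card_partition_eq_mul_zPart p
        rw [Nat.cast_eq_zero.mp h0, mul_zero] at this
        exact (Nat.factorial_ne_zero _) this.symm
      push_cast
      rw [mul_comm ((Finset.card _ : ℕ) : ℚ), ← mul_assoc, inv_mul_cancel₀ hz, one_mul]
      congr 2
      refine Finset.filter_congr fun σ _ => ⟨fun h' => h'.2, fun h' => ⟨?_, h'⟩⟩
      rw [h, ← h', Equiv.Perm.parts_partition]
      simp
    · rw [Finset.filter_eq_empty_iff.mpr, Finset.card_empty, Nat.cast_zero, zero_div]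
      rintro σ _ ⟨h1, rfl⟩
      apply h
      rw [← h1, Equiv.Perm.parts_partition]
      simp
  have := key (Fin n)
  rw [Fintype.card_fin] at this
  exact this.symm

/-- The generating series of the `𝒬ₙ`, with constant term `1`. -/
noncomputable def gSeries : PowerSeries Qmt := PowerSeries.mk (plethExp Qplus)

theorem succ_mul_coeff_succ_of_eulerD {A : Type*} [CommRing A] {F : PowerSeries A} {a : A}
    (h : eulerD F = F * PowerSeries.mk fun n => if n = 0 then 0 else a) (n : ℕ) :
    ((n : A) + 1) * PowerSeries.coeff (n + 1) F = (a + n) * PowerSeries.coeff n F := by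
  have key : ∀ n : ℕ, ((n : A) + 1) * PowerSeries.coeff (n + 1) F =
      (∑ i ∈ Finset.range (n + 1), PowerSeries.coeff i F) * a := by
    intro n
    have h1 := congrArg (PowerSeries.coeff (n + 1)) h
    rw [coeff_eulerD, PowerSeries.coeff_mul, Finset.Nat.sum_antidiagonal_eq_sum_range_succ_mk,
      Finset.sum_range_succ] at h1
    push_cast at h1
    rw [h1, Finset.sum_mul]
    simp only [PowerSeries.coeff_mk, Nat.sub_self, if_true, mul_zero, add_zero]
    refine Finset.sum_congr rfl fun i hi => ?_
    have : n + 1 - i ≠ 0 := by have := Finset.mem_range.mp hi; omega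
    rw [if_neg this]
  rw [key n, Finset.sum_range_succ]
  cases n with
  | zero => simp [mul_comm]
  | succ n =>
    rw [add_mul, ← key n]
    push_cast
    ring

theorem coeff_eq_of_succ_mul_coeff_succ {f g a : ℕ → ℚ[X]} (h0 : f 0 = g 0)
    (hf : ∀ n : ℕ, ((n : ℚ[X]) + 1) * f (n + 1) = a n * f n)
    (hg : ∀ n : ℕ, ((n : ℚ[X]) + 1) * g (n + 1) = a n * g n) (n : ℕ) : f n = g n := by
  induction n with
  | zero => exact h0
  | succ n ih =>
    have h1 : ((n : ℚ[X]) + 1) ≠ 0 := by exact_mod_cast Nat.succ_ne_zero n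
    exact mul_left_cancel₀ h1 (by rw [hf, hg, ih])

theorem coeff_tPow {d : ℕ} (hd : 0 < d) (f : Qmt) (i : ℕ) :
    (tPow d f).coeff i = if d ∣ i then f.coeff (i / d) else 0 := by
  rw [tPow, ← expand_eq_comp_X_pow, coeff_expand hd]

theorem Qplus_coeff_zero (n : ℕ) : (Qplus n).coeff 0 = if n = 1 then X else 0 := by
  split_ifs with h
  · rw [h, Qplus_one, mPoly, coeff_C_zero]
  · rcases Nat.lt_or_ge n 2 with hn | hn
    · obtain rfl : n = 0 := by omega
      rw [Qplus_zero, coeff_zero]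
    · rw [Qplus_eq_sum (by omega), finsetSum_coeff]
      refine Finset.sum_eq_zero fun lam _ => ?_
      rw [mul_coeff_zero, finsetSum_coeff, Finset.sum_eq_zero, zero_mul]
      intro i hi
      have := (Finset.mem_Icc.mp hi).1
      rw [coeff_X_pow, if_neg (by omega)]

theorem eulerD_tCoeff_zero_gSeries : eulerD (tCoeff 0 gSeries) =
    tCoeff 0 gSeries * PowerSeries.mk fun n => if n = 0 then 0 else X := by
  rw [← tCoeff_eulerD, gSeries, eulerD_plethExp, tCoeff_mul]
  rw [Finset.Nat.antidiagonal_zero, Finset.sum_singleton]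
  refine congrArg (fun b => tCoeff 0 (PowerSeries.mk (plethExp Qplus)) * b)
    (PowerSeries.ext fun n => ?_)
  rw [coeff_tCoeff, PowerSeries.coeff_mk, PowerSeries.coeff_mk, finsetSum_coeff]
  split_ifs with h
  · simp [h]
  · rw [Finset.sum_eq_single_of_mem 1 (by simpa using h)]
    · rw [coeff_natCast_mul, coeff_tPow (by simpa using Nat.pos_of_ne_zero h)]
      simp [Qplus_coeff_zero]
    · intro d hd hd1
      have := Nat.div_pos (Nat.divisor_le hd) (Nat.pos_of_mem_divisors hd)
      rw [coeff_natCast_mul, coeff_tPow this]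
      simp [Qplus_coeff_zero, hd1]

theorem coeff_zero_tCoeff_zero_gSeries : PowerSeries.coeff 0 (tCoeff 0 gSeries) = 1 := by
  rw [coeff_tCoeff, gSeries, PowerSeries.coeff_mk, plethExp_zero, coeff_one_zero]

theorem coeff_coeff_tCoeff_zero_gSeries (n i : ℕ) :
    (PowerSeries.coeff n (tCoeff 0 gSeries)).coeff i = (stirC n i : ℚ) / n.factorial := by
  rw [← coeff_coeff_zero_plethH_mPoly]
  refine congrArg (fun p : ℚ[X] => p.coeff i) ?_
  have h := eulerD_plethH mPoly
  simp only [tPow_mPoly] at h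
  refine coeff_eq_of_succ_mul_coeff_succ
    (f := fun n => PowerSeries.coeff n (tCoeff 0 gSeries)) (g := fun n => (plethH n mPoly).coeff 0)
    (a := fun n => X + (n : ℚ[X])) ?_
    (succ_mul_coeff_succ_of_eulerD eulerD_tCoeff_zero_gSeries) (fun n => ?_) n
  · rw [coeff_zero_tCoeff_zero_gSeries, plethH_zero, coeff_one_zero]
  · have h1 := congrArg (fun p : Qmt => p.coeff 0) (succ_mul_coeff_succ_of_eulerD h n)
    simp only [PowerSeries.coeff_mk, mul_coeff_zero, coeff_add, coeff_natCast_ite, if_true,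
      coeff_one_zero, mPoly, coeff_C_zero] at h1
    exact h1

theorem eulerD_tCoeff_zero_gSeries_pow (K : ℕ) : eulerD (tCoeff 0 gSeries ^ K) =
    tCoeff 0 gSeries ^ K * PowerSeries.mk fun n => if n = 0 then 0 else (K : ℚ[X]) * X := by
  rw [eulerD_pow (b := PowerSeries.mk fun n => if n = 0 then 0 else X)
    (by rw [eulerD_tCoeff_zero_gSeries, mul_comm]), mul_comm]
  refine congrArg (fun b => tCoeff 0 gSeries ^ K * b) (PowerSeries.ext fun n => ?_)
  rw [← map_natCast (PowerSeries.C (R := ℚ[X])), PowerSeries.coeff_C_mul, PowerSeries.coeff_mk,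
    PowerSeries.coeff_mk, mul_ite, mul_zero]

theorem coeff_tCoeff_zero_gSeries_pow (K n : ℕ) :
    PowerSeries.coeff n (tCoeff 0 gSeries ^ K) =
      (PowerSeries.coeff n (tCoeff 0 gSeries)).comp (C (K : ℚ) * X) := by
  refine coeff_eq_of_succ_mul_coeff_succ
    (f := fun n => PowerSeries.coeff n (tCoeff 0 gSeries ^ K))
    (g := fun n => (PowerSeries.coeff n (tCoeff 0 gSeries)).comp (C (K : ℚ) * X))
    (a := fun n => (K : ℚ[X]) * X + (n : ℚ[X])) ?_
    (succ_mul_coeff_succ_of_eulerD (eulerD_tCoeff_zero_gSeries_pow K)) (fun n => ?_) n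
  · have h := coeff_zero_tCoeff_zero_gSeries
    have h1 : PowerSeries.coeff 0 (tCoeff 0 gSeries ^ K) = 1 := by
      rw [PowerSeries.coeff_zero_eq_constantCoeff_apply] at h ⊢
      rw [map_pow, h, one_pow]
    rw [h, h1, one_comp]
  · have h1 := congrArg (fun p : ℚ[X] => p.comp (C (K : ℚ) * X))
      (succ_mul_coeff_succ_of_eulerD eulerD_tCoeff_zero_gSeries n)
    simpa using h1

theorem hasRate_tCoeff_zero_gSeries : HasRate 1 (tCoeff 0 gSeries) := by
  have hdeg : ∀ n, (PowerSeries.coeff n (tCoeff 0 gSeries)).natDegree ≤ n := by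
    intro n
    induction n with
    | zero => rw [coeff_zero_tCoeff_zero_gSeries, natDegree_one]
    | succ n ih =>
      have h := congrArg natDegree (succ_mul_coeff_succ_of_eulerD eulerD_tCoeff_zero_gSeries n)
      rw [show (n : ℚ[X]) + 1 = C ((n : ℚ) + 1) by simp, natDegree_C_mul (by positivity)] at h
      rw [h]
      refine natDegree_mul_le.trans ?_
      have : (X + (n : ℚ[X])).natDegree = 1 := by
        simpa using natDegree_X_add_C (n : ℚ)
      omega
  refine ⟨hdeg, fun j ε hε => ?_⟩
  have hb : ∀ n j : ℕ, (n.factorial : ℚ) *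
      |((PowerSeries.coeff n (tCoeff 0 gSeries)).reflect n).coeff j| ≤ ((n : ℚ) ^ 2) ^ j := by
    intro n
    induction n with
    | zero =>
      intro j
      rw [coeff_zero_tCoeff_zero_gSeries, coeff_reflect, coeff_one]
      rcases Nat.eq_zero_or_pos j with rfl | hj
      · simp
      · split_ifs with h
        · simp [revAt] at h
          omega
        · simp
    | succ n ih =>
      intro j
      have h := succ_mul_coeff_succ_of_eulerD eulerD_tCoeff_zero_gSeries n
      have hX : reflect 1 (X + (n : ℚ[X])) = 1 + C (n : ℚ) * X := by
        have h1 := reflect_monomial (R := ℚ) 1 1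
        rw [pow_one, revAt_le le_rfl, Nat.sub_self, pow_zero] at h1
        rw [← map_natCast C, reflect_add, reflect_C, h1, pow_one]
      have h2 : C ((n : ℚ) + 1) * reflect (n + 1) (PowerSeries.coeff (n + 1) (tCoeff 0 gSeries)) =
          (1 + C (n : ℚ) * X) * reflect n (PowerSeries.coeff n (tCoeff 0 gSeries)) := by
        rw [← reflect_C_mul, ← hX, ← reflect_mul _ _ ?_ (hdeg n), add_comm 1 n, ← h]
        · simp
        · simpa using (natDegree_X_add_C (n : ℚ)).le
      have h3 := congrArg (fun p : ℚ[X] => p.coeff j) h2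
      simp only [coeff_C_mul] at h3
      rw [Nat.factorial_succ]
      have h4 : (0 : ℚ) ≤ n + 1 := by positivity
      push_cast
      rw [mul_comm ((n : ℚ) + 1), mul_assoc, ← abs_of_nonneg h4, ← abs_mul, h3, abs_of_nonneg h4]
      have h5 : (n : ℚ) ^ 2 ≤ ((n : ℚ) + 1) ^ 2 := by gcongr; linarith
      rw [add_mul, one_mul, mul_assoc, coeff_add, coeff_C_mul]
      cases j with
      | zero => simpa using ih 0
      | succ j =>
        rw [coeff_X_mul]
        have h6 : (0 : ℚ) ≤ n := by positivity
        calc _ ≤ (n.factorial : ℚ) *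
              (|((PowerSeries.coeff n (tCoeff 0 gSeries)).reflect n).coeff (j + 1)| +
                n * |((PowerSeries.coeff n (tCoeff 0 gSeries)).reflect n).coeff j|) := by
              refine mul_le_mul_of_nonneg_left ((abs_add_le _ _).trans ?_) (by positivity)
              rw [abs_mul, Nat.abs_cast]
          _ = (n.factorial : ℚ) *
              |((PowerSeries.coeff n (tCoeff 0 gSeries)).reflect n).coeff (j + 1)| +
                n * ((n.factorial : ℚ) *
                  |((PowerSeries.coeff n (tCoeff 0 gSeries)).reflect n).coeff j|) := by ring
          _ ≤ ((n : ℚ) ^ 2) ^ (j + 1) + n * ((n : ℚ) ^ 2) ^ j :=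
              add_le_add (ih _) (mul_le_mul_of_nonneg_left (ih _) h6)
          _ = ((n : ℚ) ^ 2) ^ j * ((n : ℚ) ^ 2 + n) := by ring
          _ ≤ (((n : ℚ) + 1) ^ 2) ^ j * ((n : ℚ) + 1) ^ 2 := by
              gcongr
              nlinarith
          _ = _ := by ring
  obtain ⟨K, hK0, hK⟩ := exists_pow_mul_pow_le (2 * j) 1 hε
  refine ⟨K, hK0, fun n => (hb n j).trans (le_trans ?_ (hK n))⟩
  rw [← pow_mul]
  refine le_mul_of_one_le_right (by positivity) (one_le_pow₀ ?_)
  push_cast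
  linarith

/-- The logarithmic derivative of the series of `plethExp f`. -/
noncomputable def bSeries (f : ℕ → Qmt) : PowerSeries Qmt :=
  PowerSeries.mk fun n => ∑ d ∈ n.divisors, (d : Qmt) * tPow (n / d) (f d)

/-- The part of `bSeries f` which involves a proper power substitution. -/
noncomputable def bTail (f : ℕ → Qmt) : PowerSeries Qmt :=
  PowerSeries.mk fun n => ∑ d ∈ n.properDivisors, (d : Qmt) * tPow (n / d) (f d)

theorem tPow_one (f : Qmt) : tPow 1 f = f := by
  simp [tPow]

theorem bSeries_eq (f : ℕ → Qmt) : bSeries f = eulerD (PowerSeries.mk f) + bTail f := by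
  ext1 n
  rw [map_add, coeff_eulerD, bSeries, bTail, PowerSeries.coeff_mk, PowerSeries.coeff_mk,
    PowerSeries.coeff_mk]
  rcases Nat.eq_zero_or_pos n with rfl | hn
  · simp
  · rw [← Nat.insert_self_properDivisors hn.ne', Finset.sum_insert Nat.self_notMem_properDivisors,
      Nat.div_self hn, tPow_one]

theorem hasRate_tCoeff_bTail {f : ℕ → Qmt} {k : ℕ}
    (h : ∀ i ≤ k / 2, ∀ n, ((f n).coeff i).natDegree ≤ n) : HasRate 0 (tCoeff k (bTail f)) := by
  refine HasRate.of_natDegree_le_half fun n => ?_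
  rw [coeff_tCoeff, bTail, PowerSeries.coeff_mk, finsetSum_coeff]
  refine natDegree_sum_le_of_forall_le _ _ fun d hd => ?_
  obtain ⟨⟨e, rfl⟩, hlt⟩ := Nat.mem_properDivisors.mp hd
  have hd0 : 0 < d := Nat.pos_of_ne_zero fun h0 => by simp [h0] at hlt
  have he : 2 ≤ e := by
    by_contra hcon
    have : e ≤ 1 := by omega
    have := Nat.mul_le_mul_left d this
    omega
  rw [Nat.mul_div_cancel_left _ hd0, coeff_natCast_mul, coeff_tPow (by omega),
    ← map_natCast (C : ℚ →+* ℚ[X])]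
  refine (natDegree_C_mul_le _ _).trans ?_
  have hde : d ≤ d * e / 2 := by
    rw [Nat.le_div_iff_mul_le two_pos]
    exact Nat.mul_le_mul_left d he
  split_ifs
  · exact (h _ (Nat.div_le_div_left he two_pos) d).trans hde
  · simp

/-- The generating series of the `𝒬ₙ⁺`. -/
noncomputable def qplusSeries : PowerSeries Qmt := PowerSeries.mk Qplus

/-- The degree-zero part in `t` of the generating series of the `𝒬ₙ`. -/
noncomputable def eSeries : PowerSeries ℚ[X] := tCoeff 0 gSeries

/-- The logarithmic derivative `m (x + x ^ 2 + ⋯)` of `eSeries`. -/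
noncomputable def betaSeries : PowerSeries ℚ[X] := PowerSeries.mk fun n => if n = 0 then 0 else X

theorem eulerD_eSeries : eulerD eSeries = betaSeries * eSeries := by
  rw [mul_comm]
  exact eulerD_tCoeff_zero_gSeries

theorem hasRate_eSeries : HasRate 1 eSeries := hasRate_tCoeff_zero_gSeries

theorem coeff_zero_eSeries : PowerSeries.coeff 0 eSeries = 1 := coeff_zero_tCoeff_zero_gSeries

theorem coeff_zero_eSeries_pow (K : ℕ) : PowerSeries.coeff 0 (eSeries ^ K) = 1 := by
  have h := coeff_zero_eSeries
  rw [PowerSeries.coeff_zero_eq_constantCoeff_apply] at h ⊢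
  rw [map_pow, h, one_pow]

theorem exists_eSeries_mul_eq_one : ∃ e' : PowerSeries ℚ[X], eSeries * e' = 1 := by
  refine ⟨PowerSeries.invOfUnit eSeries 1, PowerSeries.mul_invOfUnit _ _ ?_⟩
  rw [← PowerSeries.coeff_zero_eq_constantCoeff_apply, coeff_zero_eSeries, Units.val_one]

theorem eulerD_of_eSeries_mul_eq_one {e' : PowerSeries ℚ[X]} (he : eSeries * e' = 1) :
    eulerD e' = -(betaSeries * e') := by
  have h := congrArg eulerD he
  rw [eulerD_mul, eulerD_one, eulerD_eSeries] at h
  linear_combination e' * h - (eulerD e' + betaSeries * e') * he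

theorem tCoeff_zero_qplusSeries : HasRate 0 (tCoeff 0 qplusSeries) := by
  refine HasRate.of_coeff_eq_zero 1 (fun n => ?_) (fun n hn => ?_)
  · rw [coeff_tCoeff, qplusSeries, PowerSeries.coeff_mk, Qplus_coeff_zero]
    split_ifs with h
    · rw [h, natDegree_X]
    · simp
  · rw [coeff_tCoeff, qplusSeries, PowerSeries.coeff_mk, Qplus_coeff_zero, if_neg (by omega)]

theorem HasRate.of_sub_C_mul_pow {i : ℕ} {c : ℚ} {F : PowerSeries ℚ[X]}
    (h : HasRate i (F - PowerSeries.C (C c) * eSeries ^ (i + 1))) : HasRate (i + 1) F := by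
  have := (h.mono (Nat.le_succ i)).add ((hasRate_eSeries.pow (i + 1)).C_mul c)
  simpa using this

theorem hasRate_tCoeff_qplusSeries {L : ℕ} (h : ∀ i < L, HasRate i
      (tCoeff (i + 1) qplusSeries - PowerSeries.C (C (ck i)) * eSeries ^ (i + 1)))
    (i : ℕ) (hi : i ≤ L) : HasRate i (tCoeff i qplusSeries) := by
  cases i with
  | zero => exact tCoeff_zero_qplusSeries
  | succ i => exact (h i hi).of_sub_C_mul_pow

theorem natDegree_coeff_Qplus_le {L : ℕ} (h : ∀ i < L, HasRate i
      (tCoeff (i + 1) qplusSeries - PowerSeries.C (C (ck i)) * eSeries ^ (i + 1)))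
    (i : ℕ) (hi : i ≤ L) (n : ℕ) : ((Qplus n).coeff i).natDegree ≤ n := by
  have := (hasRate_tCoeff_qplusSeries h i hi).degree n
  rwa [coeff_tCoeff, qplusSeries, PowerSeries.coeff_mk] at this

theorem eulerD_eSeries_pow (K : ℕ) :
    eulerD (eSeries ^ K) = PowerSeries.C (C (K : ℚ)) * (betaSeries * eSeries ^ K) := by
  rw [eulerD_pow eulerD_eSeries]
  simp [mul_assoc]

theorem tCoeff_zero_bSeries_Qplus : tCoeff 0 (bSeries Qplus) = betaSeries := by
  obtain ⟨e', he⟩ := exists_eSeries_mul_eq_one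
  have h : eulerD gSeries = gSeries * bSeries Qplus := eulerD_plethExp Qplus
  have h1 := congrArg (tCoeff 0) h
  rw [tCoeff_eulerD, tCoeff_mul, Finset.Nat.antidiagonal_zero, Finset.sum_singleton] at h1
  have h2 : eulerD eSeries = eSeries * tCoeff 0 (bSeries Qplus) := h1
  rw [eulerD_eSeries] at h2
  linear_combination (betaSeries - tCoeff 0 (bSeries Qplus)) * he - e' * h2

theorem hasRate_gSeries_mul_sub {e' : PowerSeries ℚ[X]} (he : eSeries * e' = 1) (K : ℕ)
    (hq : ∀ i < K + 1, HasRate i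
      (tCoeff (i + 1) qplusSeries - PowerSeries.C (C (ck i)) * eSeries ^ (i + 1))) :
    HasRate K (tCoeff (K + 1) gSeries * e' -
      PowerSeries.C (C (ck (K + 1))) * eSeries ^ (K + 1)) := by
  induction K using Nat.strong_induction_on with
  | _ K ih =>
  set b : ℕ → PowerSeries ℚ[X] := fun i => tCoeff i (bSeries Qplus) with hb
  set g : ℕ → PowerSeries ℚ[X] := fun i => tCoeff i gSeries * e' with hg
  have hg0 : g 0 = 1 := he
  have hε : ∀ q ≤ K, HasRate q (b (q + 1) - PowerSeries.C (C (ck q)) * eulerD (eSeries ^ (q + 1))) := by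
    intro q hqK
    have h1 := (hq q (by omega)).eulerD
    have h2 : HasRate q (tCoeff (q + 1) (bTail Qplus)) :=
      (hasRate_tCoeff_bTail fun i hi =>
        natDegree_coeff_Qplus_le hq i (by omega)).mono (Nat.zero_le q)
    have h3 := h1.add h2
    rw [eulerD_sub, eulerD_C_mul] at h3
    have h4 : b (q + 1) = eulerD (tCoeff (q + 1) qplusSeries) + tCoeff (q + 1) (bTail Qplus) := by
      rw [hb]
      simp only [bSeries_eq, tCoeff_add, tCoeff_eulerD, qplusSeries]
    rw [h4]
    convert h3 using 1
    ring
  have hbr : ∀ q ≤ K, HasRate (q + 1) (b (q + 1)) := by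
    intro q hqK
    have := ((hε q hqK).mono (Nat.le_succ q)).add (((hasRate_eSeries.pow (q + 1)).eulerD).C_mul (ck q))
    simpa using this
  have hD : eulerD (g (K + 1)) = ∑ p ∈ Finset.HasAntidiagonal.antidiagonal K, g p.1 * b (p.2 + 1) := by
    have h : eulerD gSeries = gSeries * bSeries Qplus := eulerD_plethExp Qplus
    have h1 := congrArg (tCoeff (K + 1)) h
    rw [tCoeff_eulerD, tCoeff_mul, Finset.Nat.antidiagonal_succ', Finset.sum_cons,
      Finset.sum_map, tCoeff_zero_bSeries_Qplus] at h1
    rw [hg, eulerD_mul, eulerD_of_eSeries_mul_eq_one he, h1, add_mul, Finset.sum_mul]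
    simp only [Function.Embedding.prodMap, Function.Embedding.coeFn_mk, Prod.map,
      Function.Embedding.refl_apply, Nat.succ_eq_add_one]
    rw [show ∀ a b c d : PowerSeries ℚ[X], a * b * c + d + a * -(b * c) = d by intros; ring]
    exact Finset.sum_congr rfl fun p _ => by ring
  have hterm : ∀ p ∈ Finset.HasAntidiagonal.antidiagonal K, HasRate K (g p.1 * b (p.2 + 1) -
      PowerSeries.C (C ((((p.2 : ℚ) + 1) * ck p.2) * ck p.1)) * (betaSeries * eSeries ^ (K + 1))) := by
    intro p hp
    have hp := Finset.HasAntidiagonal.mem_antidiagonal.mp hp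
    have h1 : HasRate K (PowerSeries.C (C (ck p.1)) * (eSeries ^ p.1 *
        (b (p.2 + 1) - PowerSeries.C (C (ck p.2)) * eulerD (eSeries ^ (p.2 + 1))))) := by
      have := (hasRate_eSeries.pow p.1).mul (hε p.2 (by omega))
      rw [hp] at this
      exact this.C_mul _
    have h2 : HasRate K ((g p.1 - PowerSeries.C (C (ck p.1)) * eSeries ^ p.1) * b (p.2 + 1)) := by
      rcases p with ⟨p1, p2⟩
      cases p1 with
      | zero =>
        simp only [hg0, ck]
        simpa using HasRate.zero K
      | succ p1 =>
        have := (ih p1 (by simp only at hp; omega)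
          (fun i hi => hq i (by simp only at hp; omega))).mul (hbr p2 (by simp only at hp; omega))
        refine HasRate.mono (le_of_eq ?_) this
        simp only at hp; omega
    convert h1.add h2 using 1
    rw [eulerD_eSeries_pow, ← hp]
    simp only [map_mul]
    push_cast
    ring
  have hsum := HasRate.sum _ hterm
  rw [Finset.sum_sub_distrib, ← hD, ← Finset.sum_mul, ← map_sum, ← map_sum] at hsum
  have hcoef : ∑ p ∈ Finset.HasAntidiagonal.antidiagonal K, (((p.2 : ℚ) + 1) * ck p.2) * ck p.1 =
      ck (K + 1) * ((K + 1 : ℕ) : ℚ) := by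
    rw [← Finset.Nat.sum_antidiagonal_swap]
    push_cast
    rw [mul_comm (ck _), ← sum_succ_mul_ck_mul_ck]
    rfl
  rw [hcoef, C_mul, map_mul, mul_assoc, ← eulerD_eSeries_pow, ← eulerD_C_mul, ← eulerD_sub] at hsum
  refine hsum.of_eulerD ?_
  have hG : PowerSeries.coeff 0 (tCoeff (K + 1) gSeries) = 0 := by
    rw [coeff_tCoeff, gSeries, PowerSeries.coeff_mk, plethExp_zero, coeff_one, if_neg (by omega)]
  rw [map_sub, PowerSeries.coeff_C_mul, coeff_zero_eSeries_pow, hg,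
    PowerSeries.coeff_mul, Finset.Nat.antidiagonal_zero, Finset.sum_singleton, hG]
  simp

theorem hasRate_gSeries_sub {K : ℕ}
    (hq : ∀ i < K, HasRate i
      (tCoeff (i + 1) qplusSeries - PowerSeries.C (C (ck i)) * eSeries ^ (i + 1))) :
    HasRate K (tCoeff K gSeries - PowerSeries.C (C (ck K)) * eSeries ^ (K + 1)) := by
  cases K with
  | zero =>
    have : tCoeff 0 gSeries - PowerSeries.C (C (ck 0)) * eSeries ^ (0 + 1) = 0 := by
      simp [ck, eSeries]
    rw [this]
    exact HasRate.zero 0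
  | succ K =>
    obtain ⟨e', he⟩ := exists_eSeries_mul_eq_one
    convert (hasRate_gSeries_mul_sub he K hq).mul hasRate_eSeries using 1
    linear_combination -tCoeff (K + 1) gSeries * he

/-- The generating series of the `ℓ(λ)`-weighted sums, with one factor `t` for each part. -/
noncomputable def gSeriesX : PowerSeries Qmt := PowerSeries.mk (plethExp fun i => X * Qplus i)

theorem coeff_gSeriesX_zero : PowerSeries.coeff 0 gSeriesX = 1 := by
  rw [gSeriesX, PowerSeries.coeff_mk, plethExp_zero]

theorem coeff_gSeriesX_one : PowerSeries.coeff 1 gSeriesX = X * mPoly := by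
  rw [gSeriesX, PowerSeries.coeff_mk, plethExp_one, Qplus_one]

theorem coeff_gSeriesX {n : ℕ} (hn : 2 ≤ n) :
    PowerSeries.coeff n gSeriesX = X ^ 2 * PowerSeries.coeff n gSeries := by
  rw [gSeriesX, PowerSeries.coeff_mk, plethExp_X_mul_Qplus hn, gSeries, PowerSeries.coeff_mk]

theorem coeff_gSeries_zero : PowerSeries.coeff 0 gSeries = 1 := by
  rw [gSeries, PowerSeries.coeff_mk, plethExp_zero]

theorem coeff_gSeries_one : PowerSeries.coeff 1 gSeries = mPoly := by
  rw [gSeries, PowerSeries.coeff_mk, plethExp_one, Qplus_one]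

theorem natDegree_coeff_mPoly_le (i : ℕ) : (mPoly.coeff i).natDegree ≤ 1 := by
  rw [mPoly, coeff_C]
  split_ifs <;> simp

theorem natDegree_coeff_one_le (i : ℕ) : ((1 : Qmt).coeff i).natDegree ≤ 0 := by
  rw [coeff_one]
  split_ifs <;> simp

theorem tCoeff_zero_gSeriesX : tCoeff 0 gSeriesX = 1 := by
  ext1 n
  rw [coeff_tCoeff, PowerSeries.coeff_one]
  rcases n with _ | _ | n
  · simp [-PowerSeries.coeff_zero_eq_constantCoeff, coeff_gSeriesX_zero]
  · rw [coeff_gSeriesX_one]; simp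
  · rw [coeff_gSeriesX (by omega)]; simp

theorem hasRate_tCoeff_one_gSeriesX : HasRate 0 (tCoeff 1 gSeriesX) := by
  have h : ∀ n, 1 < n → PowerSeries.coeff n (tCoeff 1 gSeriesX) = 0 := by
    intro n hn
    rw [coeff_tCoeff, coeff_gSeriesX hn, coeff_X_pow_mul', if_neg (by norm_num)]
  refine HasRate.of_coeff_eq_zero 1 (fun n => ?_) h
  rcases n with _ | _ | n
  · rw [coeff_tCoeff, coeff_gSeriesX_zero]
    exact natDegree_coeff_one_le 1
  · rw [coeff_tCoeff, coeff_gSeriesX_one, coeff_X_mul]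
    exact natDegree_coeff_mPoly_le 0
  · rw [h _ (by omega)]; simp

theorem hasRate_tCoeff_gSeriesX_sub (L : ℕ) :
    HasRate 0 (tCoeff (L + 2) gSeriesX - tCoeff L gSeries) := by
  have h : ∀ n, 1 < n → PowerSeries.coeff n (tCoeff (L + 2) gSeriesX - tCoeff L gSeries) = 0 := by
    intro n hn
    rw [map_sub, coeff_tCoeff, coeff_tCoeff, coeff_gSeriesX hn, coeff_X_pow_mul, sub_self]
  refine HasRate.of_coeff_eq_zero 1 (fun n => ?_) h
  rcases n with _ | _ | n
  · rw [map_sub, coeff_tCoeff, coeff_tCoeff, coeff_gSeriesX_zero, coeff_gSeries_zero]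
    exact (natDegree_sub_le _ _).trans
      (max_le (natDegree_coeff_one_le _) (natDegree_coeff_one_le _))
  · rw [map_sub, coeff_tCoeff, coeff_tCoeff, coeff_gSeriesX_one, coeff_gSeries_one, coeff_X_mul]
    exact (natDegree_sub_le _ _).trans
      (max_le (natDegree_coeff_mPoly_le _) (natDegree_coeff_mPoly_le _))
  · rw [h _ (by omega)]; simp

theorem tCoeff_succ_bSeries_X_mul_Qplus (i : ℕ) :
    tCoeff (i + 1) (bSeries fun n => X * Qplus n) =
      eulerD (tCoeff i qplusSeries) + tCoeff (i + 1) (bTail fun n => X * Qplus n) := by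
  rw [bSeries_eq, tCoeff_add, tCoeff_eulerD]
  refine congrArg (fun F => eulerD F + tCoeff (i + 1) (bTail fun n => X * Qplus n))
    (PowerSeries.ext fun n => ?_)
  simp only [coeff_tCoeff, qplusSeries, PowerSeries.coeff_mk, coeff_X_mul]

theorem tCoeff_zero_bSeries_X_mul_Qplus : tCoeff 0 (bSeries fun n => X * Qplus n) = 0 := by
  have h : eulerD gSeriesX = gSeriesX * bSeries fun n => X * Qplus n := eulerD_plethExp _
  have h1 := congrArg (tCoeff 0) h
  rw [tCoeff_eulerD, tCoeff_mul, Finset.Nat.antidiagonal_zero, Finset.sum_singleton,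
    tCoeff_zero_gSeriesX, eulerD_one, one_mul] at h1
  exact h1.symm

theorem hasRate_tCoeff_bTail_X_mul_Qplus {L : ℕ} (h : ∀ i < L, HasRate i
      (tCoeff (i + 1) qplusSeries - PowerSeries.C (C (ck i)) * eSeries ^ (i + 1)))
    (i : ℕ) (hi : i ≤ L + 2) : HasRate 0 (tCoeff i (bTail fun n => X * Qplus n)) := by
  refine hasRate_tCoeff_bTail fun s hs n => ?_
  cases s with
  | zero => simp
  | succ s =>
    rw [coeff_X_mul]
    exact natDegree_coeff_Qplus_le h s (by omega) n

theorem hasRate_qplusSeries_sub (L : ℕ) : HasRate L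
    (tCoeff (L + 1) qplusSeries - PowerSeries.C (C (ck L)) * eSeries ^ (L + 1)) := by
  induction L using Nat.strong_induction_on with
  | _ L hq =>
  have hG : ∀ i ≤ L, HasRate i (tCoeff i gSeries - PowerSeries.C (C (ck i)) * eSeries ^ (i + 1)) :=
    fun i hi => hasRate_gSeries_sub fun s hs => hq s (by omega)
  have hg : ∀ i ≤ L, HasRate i (tCoeff (i + 1) gSeriesX) := by
    intro i hi
    cases i with
    | zero => exact hasRate_tCoeff_one_gSeriesX
    | succ i =>
      have h1 := (hasRate_tCoeff_gSeriesX_sub i).mono (Nat.zero_le (i + 1))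
      have := h1.add (hG i (by omega)).of_sub_C_mul_pow
      simpa using this
  have hb : ∀ i ≤ L, HasRate i (tCoeff (i + 1) (bSeries fun n => X * Qplus n)) := by
    intro i hi
    rw [tCoeff_succ_bSeries_X_mul_Qplus]
    exact (hasRate_tCoeff_qplusSeries hq i hi).eulerD.add
      ((hasRate_tCoeff_bTail_X_mul_Qplus hq (i + 1) (by omega)).mono (Nat.zero_le i))
  have hD : eulerD (tCoeff (L + 2) gSeriesX) =
      eulerD (tCoeff (L + 1) qplusSeries) + tCoeff (L + 2) (bTail fun n => X * Qplus n) +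
        ∑ p ∈ Finset.HasAntidiagonal.antidiagonal L, tCoeff (p.1 + 1) gSeriesX *
          tCoeff (p.2 + 1) (bSeries fun n => X * Qplus n) := by
    have h : eulerD gSeriesX = gSeriesX * bSeries fun n => X * Qplus n := eulerD_plethExp _
    have h1 := congrArg (tCoeff (L + 2)) h
    rw [tCoeff_eulerD, tCoeff_mul, Finset.Nat.antidiagonal_succ, Finset.sum_cons, Finset.sum_map,
      tCoeff_zero_gSeriesX, one_mul, Finset.Nat.antidiagonal_succ', Finset.sum_cons,
      Finset.sum_map, tCoeff_succ_bSeries_X_mul_Qplus] at h1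
    simpa [tCoeff_zero_bSeries_X_mul_Qplus] using h1
  have hsum : HasRate L (∑ p ∈ Finset.HasAntidiagonal.antidiagonal L, tCoeff (p.1 + 1) gSeriesX *
      tCoeff (p.2 + 1) (bSeries fun n => X * Qplus n)) := by
    refine HasRate.sum _ fun p hp => ?_
    have hp := Finset.HasAntidiagonal.mem_antidiagonal.mp hp
    exact ((hg p.1 (by omega)).mul (hb p.2 (by omega))).mono hp.le
  have h1 := ((hasRate_tCoeff_gSeriesX_sub L).mono (Nat.zero_le L)).eulerD
  have h2 := (hG L le_rfl).eulerD
  have h3 := (hasRate_tCoeff_bTail_X_mul_Qplus hq (L + 2) le_rfl).mono (Nat.zero_le L)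
  have h4 := ((h1.add h2).sub h3).sub hsum
  refine HasRate.of_eulerD ?_ ?_
  · convert h4 using 1
    rw [eulerD_sub, eulerD_sub, eulerD_sub, hD]
    ring
  · rw [map_sub, PowerSeries.coeff_C_mul, coeff_zero_eSeries_pow, coeff_tCoeff, qplusSeries,
      PowerSeries.coeff_mk, Qplus_zero]
    simp

theorem hasRate_gSeries_sub_C_mul (K : ℕ) :
    HasRate K (tCoeff K gSeries - PowerSeries.C (C (ck K)) * eSeries ^ (K + 1)) :=
  hasRate_gSeries_sub fun i _ => hasRate_qplusSeries_sub i

/-- The generating series of the `𝒬ₙ` with `n ≥ 2`. -/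
noncomputable def qTrunc : PowerSeries Qmt := PowerSeries.mk fun n => if n < 2 then 0 else Qfull n

/-- The generating series of the polynomials `𝒬_{n/2}^{[2]}`. -/
noncomputable def sqSeries : PowerSeries Qmt :=
  PowerSeries.mk fun n => if 2 ∣ n then tPow 2 (Qfull (n / 2)) else 0

theorem coeff_gSeries (n : ℕ) : PowerSeries.coeff n gSeries = Qfull n := by
  rw [gSeries, PowerSeries.coeff_mk, Qfull_eq_plethExp]

theorem Prhs_eq_coeff (n : ℕ) : Prhs n = PowerSeries.coeff n
    (gSeries - PowerSeries.C (C (C (2 : ℚ)⁻¹)) * (PowerSeries.C X * (qTrunc * qTrunc - sqSeries))) := by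
  rw [map_sub, PowerSeries.coeff_C_mul, PowerSeries.coeff_C_mul, map_sub, coeff_gSeries, Prhs,
    sqSeries, PowerSeries.coeff_mk, mul_assoc]
  refine congrArg (fun s => Qfull n - C (C (2 : ℚ)⁻¹) * (X * (s - _))) ?_
  rw [PowerSeries.coeff_mul, Finset.Nat.sum_antidiagonal_eq_sum_range_succ_mk]
  symm
  refine (Finset.sum_subset_zero_on_sdiff (fun i hi => ?_) (fun i hi => ?_) fun i hi => ?_).symm
  · have := Finset.mem_Icc.mp hi
    exact Finset.mem_range.mpr (by omega)
  · have h := Finset.mem_sdiff.mp hi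
    rw [Finset.mem_range, Finset.mem_Icc] at h
    simp only [qTrunc, PowerSeries.coeff_mk]
    rcases Nat.lt_or_ge i 2 with h2 | h2
    · rw [if_pos h2, zero_mul]
    · rw [if_pos (show n - i < 2 by omega), mul_zero]
  · have h := Finset.mem_Icc.mp hi
    simp only [qTrunc, PowerSeries.coeff_mk]
    rw [if_neg (by omega), if_neg (by omega)]

theorem hasRate_tCoeff_gSeries (K : ℕ) : HasRate (K + 1) (tCoeff K gSeries) :=
  (hasRate_gSeries_sub_C_mul K).of_sub_C_mul_pow

theorem hasRate_qTrunc_sub (K : ℕ) :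
    HasRate K (tCoeff K qTrunc - PowerSeries.C (C (ck K)) * eSeries ^ (K + 1)) := by
  refine (hasRate_gSeries_sub_C_mul K).congr 1 (fun n => ?_) fun n hn => ?_
  · rw [map_sub]
    refine (natDegree_sub_le _ _).trans
      (max_le ?_ (((hasRate_eSeries.pow (K + 1)).C_mul (ck K)).degree n))
    rw [coeff_tCoeff, qTrunc, PowerSeries.coeff_mk]
    split_ifs
    · simp
    · rw [← coeff_gSeries, ← coeff_tCoeff]
      exact (hasRate_tCoeff_gSeries K).degree n
  · rw [map_sub, map_sub, coeff_tCoeff, coeff_tCoeff, coeff_gSeries, qTrunc, PowerSeries.coeff_mk,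
      if_neg (by omega)]

theorem hasRate_tCoeff_sqSeries (K : ℕ) : HasRate 0 (tCoeff K sqSeries) := by
  refine HasRate.of_natDegree_le_half fun n => ?_
  rw [coeff_tCoeff, sqSeries, PowerSeries.coeff_mk]
  split_ifs with h
  · rw [coeff_tPow two_pos]
    split_ifs
    · have := (hasRate_tCoeff_gSeries (K / 2)).degree (n / 2)
      rwa [coeff_tCoeff, coeff_gSeries] at this
    · simp
  · simp

theorem hasRate_qTrunc_mul_qTrunc_sub (K : ℕ) :
    HasRate (K + 1) (tCoeff K (qTrunc * qTrunc) -
      PowerSeries.C (C (∑ p ∈ Finset.HasAntidiagonal.antidiagonal K, ck p.1 * ck p.2)) *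
        eSeries ^ (K + 2)) := by
  rw [tCoeff_mul, map_sum, map_sum, Finset.sum_mul, ← Finset.sum_sub_distrib]
  refine HasRate.sum _ fun p hp => ?_
  have hp := Finset.HasAntidiagonal.mem_antidiagonal.mp hp
  have h1 := (hasRate_qTrunc_sub p.1).mul (hasRate_qTrunc_sub p.2).of_sub_C_mul_pow
  have h2 := ((hasRate_eSeries.pow (p.1 + 1)).mul (hasRate_qTrunc_sub p.2)).C_mul (ck p.1)
  convert (h1.mono (show _ ≤ K + 1 by omega)).add (h2.mono (show _ ≤ K + 1 by omega)) using 1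
  rw [← hp]
  simp only [map_mul]
  ring

theorem hasRate_Prhs_sub (K : ℕ) :
    HasRate K (tCoeff K (PowerSeries.mk Prhs) - PowerSeries.C (C (dk K)) * eSeries ^ (K + 1)) := by
  have h : PowerSeries.mk Prhs = gSeries -
      PowerSeries.C (C (C (2 : ℚ)⁻¹)) * (PowerSeries.C X * (qTrunc * qTrunc - sqSeries)) := by
    ext1 n
    rw [PowerSeries.coeff_mk, Prhs_eq_coeff]
  have hC : ∀ i (F : PowerSeries Qmt), tCoeff i (PowerSeries.C (C (C (2 : ℚ)⁻¹)) * F) =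
      PowerSeries.C (C (2 : ℚ)⁻¹) * tCoeff i F := by
    intro i F
    ext1 n
    rw [coeff_tCoeff, PowerSeries.coeff_C_mul, PowerSeries.coeff_C_mul, coeff_C_mul, coeff_tCoeff]
  rw [h, tCoeff_sub, hC]
  cases K with
  | zero =>
    have := hasRate_gSeries_sub_C_mul 0
    rw [tCoeff_zero_X_mul, mul_zero, sub_zero]
    simpa [ck, dk] using this
  | succ K =>
    rw [tCoeff_succ_X_mul, tCoeff_sub, ← ck_succ_sub_half_sum]
    have h1 := hasRate_gSeries_sub_C_mul (K + 1)
    have h2 := (hasRate_qTrunc_mul_qTrunc_sub K).C_mul (2 : ℚ)⁻¹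
    have h3 := ((hasRate_tCoeff_sqSeries K).C_mul (2 : ℚ)⁻¹).mono (Nat.zero_le (K + 1))
    convert (h1.sub h2).add h3 using 1
    simp only [map_sub, map_mul]
    ring

/-- The generating series of the `𝒫ₙ` with `n ≥ 3`. -/
noncomputable def pSeries (P : ℕ → Qmt) : PowerSeries Qmt :=
  PowerSeries.mk fun n => if n < 3 then 0 else P n

theorem hasRate_pSeries_sub {P : ℕ → Qmt}
    (hP : ∀ n : ℕ, 3 ≤ n → (1 + Polynomial.X) * P n = Prhs n) (K : ℕ) :
    HasRate K (tCoeff K (pSeries P) - PowerSeries.C (C (dk K)) * eSeries ^ (K + 1)) := by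
  have key : ∀ (K : ℕ) {F : PowerSeries ℚ[X]},
      HasRate K (F - PowerSeries.C (C (dk K)) * eSeries ^ (K + 1)) →
      (∀ n, 3 ≤ n → PowerSeries.coeff n F = (P n).coeff K) →
      HasRate K (tCoeff K (pSeries P) - PowerSeries.C (C (dk K)) * eSeries ^ (K + 1)) := by
    intro K F hF h
    have hn : ∀ n, 3 ≤ n → PowerSeries.coeff n (tCoeff K (pSeries P)) = PowerSeries.coeff n F := by
      intro n hn
      rw [h n hn, coeff_tCoeff, pSeries, PowerSeries.coeff_mk, if_neg (by omega)]
    refine hF.congr 2 (fun n => ?_) fun n h3 => ?_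
    · rw [map_sub]
      refine (natDegree_sub_le _ _).trans
        (max_le ?_ (((hasRate_eSeries.pow (K + 1)).C_mul (dk K)).degree n))
      rcases Nat.lt_or_ge n 3 with h3 | h3
      · rw [coeff_tCoeff, pSeries, PowerSeries.coeff_mk, if_pos h3]
        simp
      · rw [hn n h3]
        exact hF.of_sub_C_mul_pow.degree n
    · rw [map_sub, map_sub, hn n h3]
  induction K with
  | zero =>
    refine key 0 (hasRate_Prhs_sub 0) fun n hn => ?_
    rw [coeff_tCoeff, PowerSeries.coeff_mk, ← hP n hn, mul_coeff_zero]
    simp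
  | succ K ih =>
    have h1 := (hasRate_Prhs_sub (K + 1)).sub ih.of_sub_C_mul_pow
    rw [sub_right_comm] at h1
    refine key (K + 1) h1 fun n hn => ?_
    rw [map_sub, coeff_tCoeff, coeff_tCoeff, PowerSeries.coeff_mk, ← hP n hn, pSeries,
      PowerSeries.coeff_mk, if_neg (by omega), add_mul, one_mul, coeff_add, coeff_X_mul,
      add_sub_cancel_right]

theorem coeff_coeff_eSeries_pow (K n i : ℕ) : (PowerSeries.coeff n (eSeries ^ K)).coeff i =
    (K : ℚ) ^ i * ((stirC n i : ℚ) / n.factorial) := by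
  rw [eSeries, coeff_tCoeff_zero_gSeries_pow, comp_C_mul_X_coeff, coeff_coeff_tCoeff_zero_gSeries,
    mul_comm]

/-- Let `𝒫ₙ` (for `n ≥ 3`) be the unique polynomials satisfying
`(1+t)·𝒫ₙ = 𝒬ₙ − (t/2)(Σ_{h=2}^{n-2} 𝒬_h 𝒬_{n-h} − 𝒬_{n/2}^{[2]})`.  For fixed `j, k ≥ 0`,
as `n → ∞`, `𝒫_{n,k}^{n−j} = d_k·(k+1)^{n−j}·c(n,n−j)/n! + o((k+1)^n·n^{2j}/n!)`. -/
theorem Pnk_coeff_asymptotic (j k : ℕ)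
    (P : ℕ → Qmt) (hP : ∀ n : ℕ, 3 ≤ n → (1 + Polynomial.X) * P n = Prhs n) :
    Filter.Tendsto
      (fun n : ℕ =>
        (((P n).coeff k).coeff (n - j) -
            dk k * ((k : ℚ) + 1) ^ (n - j) * (stirC n (n - j) : ℚ) / (n.factorial : ℚ)) *
          (n.factorial : ℚ) / (((k : ℚ) + 1) ^ n * (n : ℚ) ^ (2 * j)))
      Filter.atTop (nhds 0) := by
  obtain ⟨K, hK0, hK⟩ := (hasRate_pSeries_sub hP k).bound j (1 / 2) (by norm_num)
  set q : ℚ := ((k : ℚ) + 1 / 2) / (k + 1) with hq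
  have hq0 : 0 ≤ q := by positivity
  have hq1 : q < 1 := by rw [hq, div_lt_one (by positivity)]; linarith
  have hlim : Filter.Tendsto (fun n : ℕ => K * q ^ n) Filter.atTop (nhds 0) := by
    simpa using (tendsto_pow_atTop_nhds_zero_of_lt_one hq0 hq1).const_mul K
  suffices hle : ∀ᶠ n : ℕ in Filter.atTop, |(((P n).coeff k).coeff (n - j) -
      dk k * ((k : ℚ) + 1) ^ (n - j) * (stirC n (n - j) : ℚ) / (n.factorial : ℚ)) *
        (n.factorial : ℚ) / (((k : ℚ) + 1) ^ n * (n : ℚ) ^ (2 * j))| ≤ K * q ^ n from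
    tendsto_of_tendsto_of_tendsto_of_le_of_le' (by simpa using hlim.neg) hlim
      (hle.mono fun n hn => (abs_le.mp hn).1) (hle.mono fun n hn => (abs_le.mp hn).2)
  filter_upwards [Filter.eventually_ge_atTop (max 3 j)] with n hn
  have hn3 : 3 ≤ n := le_trans (le_max_left _ _) hn
  have hnj : j ≤ n := le_trans (le_max_right _ _) hn
  have h := hK n
  rw [coeff_reflect, revAt_le hnj, map_sub, coeff_tCoeff, pSeries, PowerSeries.coeff_mk,
    if_neg (by omega), PowerSeries.coeff_C_mul, coeff_sub, coeff_C_mul, coeff_coeff_eSeries_pow] at h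
  push_cast at h
  have hn1 : (1 : ℚ) ≤ (n : ℚ) ^ (2 * j) := one_le_pow₀ (by exact_mod_cast (by omega : 1 ≤ n))
  have hk : (0 : ℚ) < ((k : ℚ) + 1) ^ n := by positivity
  rw [abs_div, abs_mul, Nat.abs_cast, abs_of_pos (mul_pos hk (by positivity)),
    div_le_iff₀ (mul_pos hk (by positivity)), hq, div_pow]
  calc _ ≤ K * ((k : ℚ) + 1 / 2) ^ n := by
        rw [mul_comm]
        refine le_trans (le_of_eq ?_) h
        congr 2
        ring
    _ = K * (((k : ℚ) + 1 / 2) ^ n / ((k : ℚ) + 1) ^ n) * (((k : ℚ) + 1) ^ n * 1) := by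
        field_simp
    _ ≤ _ := by gcongr
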